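/- Let f(x, y) be a homogeneous polynomial of degree d ≥ 3 with rational integer coefficients which is irreducible over ℚ, let H be the maximum of the absolute values of its coefficients, and let m be a nonzero rational integer. Let κ > d + 1, set ν = 32·κ²·d/(κ − d − 1) and C = exp(d^(ν²)·H^(ν·d³)). Then all rational integers x, y with f(x, y) = m satisfy max{|x|, |y|} < C·exp((log |m|)^κ). -/

import Mathlib

section NumberFieldEstimates

open NumberField

/-- The absolute norm of an algebraic integer as a product over all complex embeddings. -/
theorem prod_norm_embeddings_eq {F : Type*} [Field F] [NumberField F] (x : 𝓞 F) :
    ∏ τ : F →+* ℂ, ‖τ x‖ = ((Algebra.norm ℤ x).natAbs : ℝ) := by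
  have h := Algebra.norm_eq_prod_embeddings ℚ ℂ (x : F)
  have h2 : ∏ τ : F →+* ℂ, τ (x : F) = ∏ τ : F →ₐ[ℚ] ℂ, τ (x : F) :=
    Fintype.prod_equiv (RingHom.equivRatAlgHom F ℂ) _ _ (fun _ => rfl)
  rw [← norm_prod, h2, ← h, ← Algebra.coe_norm_int]
  simp [Nat.cast_natAbs]

/-- Liouville's inequality for algebraic integers: a nonzero algebraic integer all of whose
conjugates are bounded by `Y` cannot have a very small conjugate. -/
theorem one_le_norm_mul_pow {F : Type*} [Field F] [NumberField F] (φ : F →+* ℂ) (x : 𝓞 F)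
    (hx : x ≠ 0) {Y : ℝ} (hY : ∀ τ : F →+* ℂ, ‖τ x‖ ≤ Y) :
    1 ≤ ‖φ x‖ * Y ^ (Module.finrank ℚ F - 1) := by
  classical
  have h := prod_norm_embeddings_eq x
  have h1 : (1 : ℝ) ≤ ((Algebra.norm ℤ x).natAbs : ℝ) := by
    have : Algebra.norm ℤ x ≠ 0 := by simpa using hx
    exact_mod_cast Int.natAbs_pos.mpr this
  rw [← h, ← Finset.mul_prod_erase _ _ (Finset.mem_univ φ)] at h1
  refine h1.trans (mul_le_mul_of_nonneg_left ?_ (norm_nonneg _))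
  calc ∏ τ ∈ Finset.univ.erase φ, ‖τ x‖ ≤ ∏ τ ∈ Finset.univ.erase φ, Y :=
        Finset.prod_le_prod (fun _ _ => norm_nonneg _) (fun τ _ => hY τ)
    _ = _ := by
        rw [Finset.prod_const, Finset.card_erase_of_mem (Finset.mem_univ _), Finset.card_univ,
          Embeddings.card]

section ZeroEstimate

open Polynomial

theorem coeff_prod_sum_of_natDegree_le {ι R : Type*} [CommRing R] (s : Finset ι) (P : ι → R[X])
    (n : ι → ℕ) (h : ∀ i ∈ s, (P i).natDegree ≤ n i) :
    (∏ i ∈ s, P i).coeff (∑ i ∈ s, n i) = ∏ i ∈ s, (P i).coeff (n i) := by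
  classical
  induction s using Finset.induction_on with
  | empty => simp
  | insert a s ha ih =>
    rw [Finset.prod_insert ha, Finset.sum_insert ha, Finset.prod_insert ha,
      coeff_mul_add_eq_of_natDegree_le (h a (Finset.mem_insert_self _ _)),
      ih fun i hi => h i (Finset.mem_insert_of_mem hi)]
    exact (natDegree_prod_le _ _).trans
      (Finset.sum_le_sum fun i hi => h i (Finset.mem_insert_of_mem hi))

theorem coeff_det_sum_of_natDegree_le {ι R : Type*} [Fintype ι] [DecidableEq ι] [CommRing R]
    (A : Matrix ι ι R[X]) (n : ι → ℕ) (h : ∀ i j, (A i j).natDegree ≤ n j) :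
    A.det.coeff (∑ j, n j) = (Matrix.of fun i j => (A i j).coeff (n j)).det := by
  rw [Matrix.det_apply, Matrix.det_apply, finsetSum_coeff]
  refine Finset.sum_congr rfl fun σ _ => ?_
  rw [coeff_smul, coeff_prod_sum_of_natDegree_le _ _ _ fun i _ => h (σ i) i]
  rfl

theorem natDegree_det_le_sum {ι R : Type*} [Fintype ι] [DecidableEq ι] [CommRing R]
    (A : Matrix ι ι R[X]) (n : ι → ℕ) (h : ∀ i j, (A i j).natDegree ≤ n j) :
    A.det.natDegree ≤ ∑ j, n j := by
  rw [Matrix.det_apply]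
  refine natDegree_sum_le_of_forall_le _ _ fun σ _ => ?_
  refine (natDegree_smul_le _ _).trans ((natDegree_prod_le _ _).trans ?_)
  exact Finset.sum_le_sum fun i _ => h (σ i) i

/-- A zero estimate: a nonzero polynomial `∑ Q_l(X) Y^l` cannot vanish at all the points
`(i + x, η^i y)` with `i < L` and `(x, y)` in a large set, when `η` is not a root of unity. -/
theorem exists_sum_eval_ne_zero {L K : ℕ} (Q : Fin L → ℂ[X]) (hQ : Q ≠ 0)
    (hK : ∀ l, (Q l).natDegree ≤ K) (η : ℂ) (hη0 : η ≠ 0) (hη : ∀ n : ℕ, 0 < n → η ^ n ≠ 1)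
    {P : Type*} (s : Finset P) (x y : P → ℂ) (hy : ∀ p ∈ s, y p ≠ 0)
    (hx : Set.InjOn x s) (hs : L * K < s.card) :
    ∃ p ∈ s, ∃ i < L, ∑ l : Fin L, (Q l).eval (i + x p) * (η ^ i * y p) ^ (l : ℕ) ≠ 0 := by
  classical
  by_contra! hcon
  set I : Finset (Fin L) := Finset.univ.filter fun l => Q l ≠ 0 with hI
  have hIc : I.card ≤ L := by simpa using Finset.card_le_univ I
  let e : Fin I.card ≃ I := I.equivFin.symm
  have heQ : ∀ j, Q (e j) ≠ 0 := fun j => (Finset.mem_filter.mp (e j).2).2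
  have hinj : ∀ a b : ℕ, η ^ a = η ^ b → a = b := by
    intro a b hab
    by_contra hne
    rcases lt_or_gt_of_ne hne with h | h
    · refine hη (b - a) (by omega) ?_
      have h1 : η ^ a * η ^ (b - a) = η ^ a * 1 := by
        rw [← pow_add, mul_one, hab]; congr 1; omega
      exact mul_left_cancel₀ (pow_ne_zero _ hη0) h1
    · refine hη (a - b) (by omega) ?_
      have h1 : η ^ b * η ^ (a - b) = η ^ b * 1 := by
        rw [← pow_add, mul_one, ← hab]; congr 1; omega
      exact mul_left_cancel₀ (pow_ne_zero _ hη0) h1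
  let A : Matrix (Fin I.card) (Fin I.card) ℂ[X] := Matrix.of fun i j =>
    C ((η ^ (e j : Fin L).val) ^ (i : ℕ)) * (Q (e j)).comp (X + C (i : ℂ))
  let n : Fin I.card → ℕ := fun j => (Q (e j)).natDegree
  have hdegc : ∀ (j : Fin I.card) (c : ℂ), ((Q (e j)).comp (X + C c)).natDegree = n j := by
    intro j c
    rw [natDegree_comp, natDegree_X_add_C, mul_one]
  have hA : ∀ i j, (A i j).natDegree ≤ n j := by
    intro i j
    refine (natDegree_C_mul_le _ _).trans ?_
    exact (hdegc j i).le
  have hcoeff : A.det.coeff (∑ j, n j) ≠ 0 := by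
    rw [coeff_det_sum_of_natDegree_le A n hA]
    have h1 : (Matrix.of fun i j => (A i j).coeff (n j)) =
        Matrix.of fun i j => (Q (e j)).leadingCoeff *
          (Matrix.vandermonde fun j : Fin I.card => η ^ (e j : Fin L).val).transpose i j := by
      ext i j
      simp only [A, Matrix.of_apply, coeff_C_mul, Matrix.transpose_apply,
        Matrix.vandermonde_apply]
      rw [mul_comm]
      congr 1
      rw [← hdegc j (i : ℂ), coeff_natDegree,
        leadingCoeff_comp (by rw [natDegree_X_add_C]; exact one_ne_zero),
        leadingCoeff_X_add_C, one_pow, mul_one]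
    rw [h1, Matrix.det_mul_row, Matrix.det_transpose]
    refine mul_ne_zero (Finset.prod_ne_zero_iff.mpr fun j _ => by simpa using heQ j) ?_
    rw [Matrix.det_vandermonde_ne_zero_iff]
    intro a b hab
    exact e.injective (Subtype.ext (Fin.ext (hinj _ _ hab)))
  have hdet : A.det ≠ 0 := by
    intro h; rw [h] at hcoeff; simp at hcoeff
  have hIpos : 0 < I.card := by
    rw [Finset.card_pos]
    obtain ⟨l, hl⟩ := Function.ne_iff.mp hQ
    exact ⟨l, by simpa [hI] using hl⟩
  have hroot : ∀ p ∈ s, x p ∈ A.det.roots.toFinset := by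
    intro p hp
    rw [Multiset.mem_toFinset, mem_roots hdet, IsRoot.def]
    have h1 : A.det.eval (x p) = (A.map (eval (x p))).det := by
      have := RingHom.map_det (evalRingHom (x p)) A
      simpa [RingHom.mapMatrix_apply] using this
    rw [h1]
    refine Matrix.exists_mulVec_eq_zero_iff.mp ⟨fun j => y p ^ (e j : Fin L).val, ?_, ?_⟩
    · intro h
      exact pow_ne_zero _ (hy p hp) (congrFun h ⟨0, hIpos⟩)
    · ext i
      have h2 := hcon p hp i (lt_of_lt_of_le i.2 hIc)
      rw [← Finset.sum_subset (Finset.subset_univ I), ← Finset.sum_coe_sort,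
        ← Equiv.sum_comp e] at h2
      · simp only [Matrix.mulVec, dotProduct, Pi.zero_apply]
        rw [← h2]
        refine Finset.sum_congr rfl fun j _ => ?_
        simp only [A, Matrix.map_apply, Matrix.of_apply, eval_mul, eval_C, eval_comp, eval_add,
          eval_X, mul_pow, ← pow_mul]
        rw [add_comm (x p), mul_comm (i : ℕ)]
        ring
      · intro l _ hl
        have : Q l = 0 := by simpa [hI] using hl
        simp [this]
  have h3 : s.card ≤ A.det.roots.toFinset.card := Finset.card_le_card_of_injOn x hroot hx
  have h4 : A.det.roots.toFinset.card ≤ ∑ j, n j :=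
    (Multiset.toFinset_card_le _).trans ((card_roots' _).trans (natDegree_det_le_sum A n hA))
  have h5 : ∑ j, n j ≤ I.card * K := by
    refine (Finset.sum_le_sum fun j _ => hK (e j)).trans ?_
    simp
  have : I.card * K ≤ L * K := Nat.mul_le_mul_right _ hIc
  omega

end ZeroEstimate

/-- Two reals in `[-W, W]` falling into the same one of `q` cells are close. -/
theorem abs_sub_le_of_floor_eq {W a b : ℝ} (hW : 0 < W) {q : ℕ} (hq : 0 < q) (ha : |a| ≤ W)
    (hb : |b| ≤ W) (h : ⌊(a + W) * q / (2 * W)⌋₊ = ⌊(b + W) * q / (2 * W)⌋₊) :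
    |a - b| ≤ 2 * W / q := by
  have hq' : (0 : ℝ) < q := by exact_mod_cast hq
  have ha0 : 0 ≤ (a + W) * q / (2 * W) := by
    have := neg_le_of_abs_le ha
    have : 0 ≤ a + W := by linarith
    positivity
  have hb0 : 0 ≤ (b + W) * q / (2 * W) := by
    have := neg_le_of_abs_le hb
    have : 0 ≤ b + W := by linarith
    positivity
  have h1 := Nat.floor_le ha0
  have h2 := Nat.lt_floor_add_one ((a + W) * q / (2 * W))
  have h3 := Nat.floor_le hb0
  have h4 := Nat.lt_floor_add_one ((b + W) * q / (2 * W))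
  rw [h] at h1 h2
  have h5 : |(a + W) * q / (2 * W) - (b + W) * q / (2 * W)| ≤ 1 := by
    rw [abs_le]; constructor <;> linarith
  have h6 : (a + W) * q / (2 * W) - (b + W) * q / (2 * W) = (a - b) * (q / (2 * W)) := by
    field_simp; ring
  rw [h6, abs_mul, abs_of_pos (by positivity : 0 < (q : ℝ) / (2 * W))] at h5
  rw [le_div_iff₀ hq']
  have : |a - b| * (q / (2 * W)) = |a - b| * q / (2 * W) := by ring
  rw [this, div_le_one (by positivity)] at h5
  exact h5

theorem floor_cell_le {W a : ℝ} (hW : 0 < W) {q : ℕ} (ha : |a| ≤ W) :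
    ⌊(a + W) * q / (2 * W)⌋₊ < q + 1 := by
  have h1 := le_of_abs_le ha
  rw [Nat.lt_succ_iff]
  refine Nat.floor_le_of_le ?_
  rw [div_le_iff₀ (by positivity)]
  have : (0 : ℝ) ≤ q := by positivity
  nlinarith

/-- The box principle for complex linear forms. -/
theorem exists_int_vec_norm_le {ι : Type*} [Fintype ι] {T X q : ℕ} (M : Fin T → ι → ℂ) {Y : ℝ}
    (hY0 : 0 < Y) (hX : 0 < X) (hY : ∀ n, ∑ i, ‖M n i‖ ≤ Y) (hq : 0 < q)
    (hcard : (((q + 1) ^ 2) ^ T) < (X + 1) ^ Fintype.card ι) :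
    ∃ c : ι → ℤ, c ≠ 0 ∧ (∀ i, |c i| ≤ X) ∧ ∀ n, ‖∑ i, M n i * c i‖ ≤ 4 * (X * Y) / q := by
  classical
  set W : ℝ := X * Y with hWdef
  have hX' : (0 : ℝ) < X := by exact_mod_cast hX
  have hW : 0 < W := by positivity
  let v : (ι → Fin (X + 1)) → Fin T → ℂ := fun a n => ∑ i, M n i * ((a i : ℕ) : ℂ)
  have hv : ∀ a n, ‖v a n‖ ≤ W := by
    intro a n
    calc ‖v a n‖ ≤ ∑ i, ‖M n i * ((a i : ℕ) : ℂ)‖ := norm_sum_le _ _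
      _ ≤ ∑ i, ‖M n i‖ * X := by
          refine Finset.sum_le_sum fun i _ => ?_
          rw [norm_mul, Complex.norm_natCast]
          have : ((a i : ℕ) : ℝ) ≤ X := by exact_mod_cast Nat.lt_succ_iff.mp (a i).2
          gcongr
      _ ≤ W := by
          rw [← Finset.sum_mul, hWdef, mul_comm]
          exact mul_le_mul_of_nonneg_left (hY n) hX'.le
  let g : (ι → Fin (X + 1)) → Fin T → Fin (q + 1) × Fin (q + 1) := fun a n =>
    (⟨_, floor_cell_le hW (q := q) ((Complex.abs_re_le_norm _).trans (hv a n))⟩,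
     ⟨_, floor_cell_le hW (q := q) ((Complex.abs_im_le_norm _).trans (hv a n))⟩)
  obtain ⟨a, b, hab, hg⟩ := Fintype.exists_ne_map_eq_of_card_lt g (by
    simpa [Fintype.card_pi, ← sq] using hcard)
  refine ⟨fun i => ((a i : ℕ) : ℤ) - ((b i : ℕ) : ℤ), ?_, ?_, ?_⟩
  · intro h
    apply hab
    funext i
    have := congrFun h i
    simp only [Pi.zero_apply] at this
    apply Fin.ext
    omega
  · intro i
    have := (a i).2
    have := (b i).2
    simp only
    rw [abs_le]
    constructor <;> omega
  · intro n
    have h1 : ∑ i, M n i * (((((a i : ℕ) : ℤ) - ((b i : ℕ) : ℤ) : ℤ)) : ℂ) = v a n - v b n := by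
      simp only [v, ← Finset.sum_sub_distrib]
      refine Finset.sum_congr rfl fun i _ => ?_
      push_cast
      ring
    rw [h1]
    have h2 := congrFun hg n
    simp only [g, Prod.mk.injEq, Fin.mk.injEq] at h2
    have hre := abs_sub_le_of_floor_eq hW hq ((Complex.abs_re_le_norm _).trans (hv a n))
      ((Complex.abs_re_le_norm _).trans (hv b n)) h2.1
    have him := abs_sub_le_of_floor_eq hW hq ((Complex.abs_im_le_norm _).trans (hv a n))
      ((Complex.abs_im_le_norm _).trans (hv b n)) h2.2
    refine (Complex.norm_le_abs_re_add_abs_im _).trans ?_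
    rw [Complex.sub_re, Complex.sub_im]
    calc _ ≤ 2 * W / q + 2 * W / q := add_le_add hre him
      _ = _ := by ring

theorem norm_exp_sub_sum_le_pow_mul_exp (x : ℂ) (m : ℕ) {E : ℝ} (hE : 1 ≤ E) :
    ‖Complex.exp x - ∑ j ∈ Finset.range m, x ^ j / (j.factorial : ℂ)‖ ≤
      (E ^ m)⁻¹ * Real.exp (E * ‖x‖) := by
  refine (Complex.norm_exp_sub_sum_le_exp_norm_sub_sum x m).trans ?_
  set y := ‖x‖
  have hy : 0 ≤ y := norm_nonneg x
  have hs : ∀ z : ℝ, HasSum (fun j : ℕ => z ^ j / (j.factorial : ℝ)) (Real.exp z) := by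
    intro z
    rw [Real.exp_eq_exp_ℝ]
    exact NormedSpace.expSeries_div_hasSum_exp z
  have h1 := (hasSum_nat_add_iff' m).mpr (hs y)
  have h2 := ((hasSum_nat_add_iff' m).mpr (hs (E * y))).mul_left (E ^ m)⁻¹
  have hE0 : 0 < E := by linarith
  refine (hasSum_le (fun j => ?_) h1 h2).trans ?_
  · rw [mul_pow, pow_add E, ← mul_div_assoc]
    have h3 : (E ^ m)⁻¹ * (E ^ j * E ^ m * y ^ (j + m)) = E ^ j * y ^ (j + m) := by
      field_simp
    rw [h3]
    have : 1 ≤ E ^ j := one_le_pow₀ hE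
    have h4 : 0 ≤ y ^ (j + m) := by positivity
    gcongr
    nlinarith
  · refine mul_le_mul_of_nonneg_left ?_ (by positivity)
    have : 0 ≤ ∑ j ∈ Finset.range m, (E * y) ^ j / (j.factorial : ℝ) :=
      Finset.sum_nonneg fun j _ => by positivity
    linarith

theorem norm_one_add_pow_sub_one_le (δ : ℂ) (n : ℕ) (h : n * ‖δ‖ ≤ 1) :
    ‖(1 + δ) ^ n - 1‖ ≤ 2 * (n * ‖δ‖) := by
  have h1 : ‖(1 + δ) ^ n - 1‖ ≤ (1 + ‖δ‖) ^ n - 1 := by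
    have h2 : (1 + δ) ^ n - 1 = ∑ m ∈ Finset.range n, δ ^ (m + 1) * (n.choose (m + 1) : ℂ) := by
      rw [add_comm, add_pow, Finset.sum_range_succ']
      simp
    have h3 : (1 + ‖δ‖) ^ n - 1 =
        ∑ m ∈ Finset.range n, ‖δ‖ ^ (m + 1) * (n.choose (m + 1) : ℝ) := by
      rw [add_comm, add_pow, Finset.sum_range_succ']
      simp
    rw [h2, h3]
    refine (norm_sum_le _ _).trans (le_of_eq ?_)
    simp
  have h2 : (1 + ‖δ‖) ^ n ≤ Real.exp (n * ‖δ‖) := by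
    rw [Real.exp_nat_mul]
    gcongr
    rw [add_comm]
    exact Real.add_one_le_exp _
  have h3 := Real.abs_exp_sub_one_le (x := n * ‖δ‖) (by
    rw [abs_of_nonneg (by positivity)]; exact h)
  rw [abs_of_nonneg (a := (n : ℝ) * ‖δ‖) (by positivity)] at h3
  have := le_of_abs_le h3
  linarith

theorem sum_range_ite_le (T k : ℕ) (f : ℕ → ℂ) :
    (∑ n ∈ Finset.range T, if k ≤ n then f n else 0) =
      ∑ j ∈ Finset.range (T - k), f (k + j) := by
  rw [← Finset.sum_filter, ← Finset.sum_Ico_eq_sum_range]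
  congr 1
  ext n
  simp [and_comm]

/-- There is an exponential polynomial with small integer coefficients, not all zero, that is
uniformly small on a disc. -/
theorem exists_expPoly_small {K L T X D' : ℕ} (hK : 0 < K) (hL : 0 < L) (hX : 0 < X)
    (hD : 0 < D') (hcard : 2 * D' * T < K * L) {z₀ E : ℝ} (hz₀ : 1 ≤ z₀) (hE : 1 ≤ E) (ω : ℂ) :
    ∃ c : Fin K → Fin L → ℤ, c ≠ 0 ∧ (∀ k l, |c k l| ≤ X) ∧ ∀ z : ℂ, ‖z‖ ≤ z₀ →
      ‖∑ k, ∑ l, (c k l : ℂ) * z ^ (k : ℕ) * Complex.exp ((l : ℕ) * ω * z)‖ ≤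
        X * (K * L * (z₀ * E) ^ K * Real.exp (L * ‖ω‖ * E * z₀)) *
          (8 * T / (X + 1) ^ D' + 1 / E ^ T) := by
  set P : ℝ := K * L * (z₀ * E) ^ K * Real.exp (L * ‖ω‖ * E * z₀) with hP
  have hK' : (0 : ℝ) < K := by exact_mod_cast hK
  have hL' : (0 : ℝ) < L := by exact_mod_cast hL
  have hX' : (1 : ℝ) ≤ X := by exact_mod_cast hX
  have hE0 : 0 < E := by linarith
  have hz0 : 0 < z₀ := by linarith
  have hP0 : 0 < P := by positivity
  obtain ⟨q, hq⟩ : ∃ q, q + 1 = (X + 1) ^ D' :=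
    ⟨(X + 1) ^ D' - 1, Nat.sub_add_cancel (Nat.one_le_pow _ _ (by omega))⟩
  have hq2 : 2 ≤ q + 1 := by
    rw [hq]
    calc 2 ≤ X + 1 := by omega
      _ ≤ (X + 1) ^ D' := Nat.le_self_pow hD.ne' _
  let h : Fin L → ℕ → ℂ := fun l j => ((l : ℕ) * ω) ^ j / (j.factorial : ℂ)
  let M : Fin T → Fin K × Fin L → ℂ := fun n i =>
    if (i.1 : ℕ) ≤ n then h i.2 (n - i.1) * (z₀ : ℂ) ^ (n : ℕ) else 0
  have hM : ∀ n, ∑ i, ‖M n i‖ ≤ P := by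
    intro n
    have h1 : ∀ i, ‖M n i‖ ≤ (z₀ * E) ^ K * Real.exp (L * ‖ω‖ * E * z₀) := by
      rintro ⟨k, l⟩
      simp only [M]
      split_ifs with hkn
      · have h2 : ‖h l (n - k) * (z₀ : ℂ) ^ (n : ℕ)‖ =
            z₀ ^ (k : ℕ) * (((l : ℕ) * ‖ω‖ * z₀) ^ ((n : ℕ) - k) / (((n : ℕ) - k).factorial)) := by
          have h3 : z₀ ^ (n : ℕ) = z₀ ^ (k : ℕ) * z₀ ^ ((n : ℕ) - k) := by
            rw [← pow_add]; congr 1; omega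
          simp only [h, norm_mul, norm_div, norm_pow, Complex.norm_natCast, Complex.norm_real,
            Real.norm_eq_abs, abs_of_pos hz0, h3]
          ring
        rw [h2]
        refine mul_le_mul ?_ ?_ (by positivity) (by positivity)
        · calc z₀ ^ (k : ℕ) ≤ z₀ ^ K := pow_le_pow_right₀ hz₀ k.2.le
            _ ≤ (z₀ * E) ^ K := by gcongr; nlinarith
        · refine (Real.pow_div_factorial_le_exp _ (by positivity) _).trans ?_
          rw [Real.exp_le_exp]
          have : ((l : ℕ) : ℝ) ≤ L := by exact_mod_cast l.2.le
          calc (l : ℕ) * ‖ω‖ * z₀ ≤ L * ‖ω‖ * z₀ := by gcongr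
            _ ≤ L * ‖ω‖ * E * z₀ := by
              have : 0 ≤ L * ‖ω‖ * z₀ := by positivity
              nlinarith
      · rw [norm_zero]; positivity
    refine (Finset.sum_le_sum fun i _ => h1 i).trans (le_of_eq ?_)
    simp [hP]
    ring
  obtain ⟨c, hc0, hcX, hc⟩ := exists_int_vec_norm_le (X := X) (q := q) M hP0 hX hM (by omega) (by
    rw [hq, ← pow_mul, ← pow_mul]
    refine Nat.pow_lt_pow_right (by omega) ?_
    simp only [Fintype.card_prod, Fintype.card_fin]
    linarith)
  refine ⟨fun k l => c (k, l), ?_, fun k l => hcX _, ?_⟩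
  · intro h0
    apply hc0
    funext ⟨k, l⟩
    exact congrFun (congrFun h0 k) l
  intro z hz
  let R : Fin K × Fin L → ℂ := fun i => Complex.exp ((i.2 : ℕ) * ω * z) -
    ∑ j ∈ Finset.range (T - i.1), ((i.2 : ℕ) * ω * z) ^ j / (j.factorial : ℂ)
  have hz0' : (z₀ : ℂ) ≠ 0 := by exact_mod_cast hz0.ne'
  have key : ∀ i : Fin K × Fin L, z ^ (i.1 : ℕ) * Complex.exp ((i.2 : ℕ) * ω * z) =
      (∑ n : Fin T, M n i * (z / z₀) ^ (n : ℕ)) + z ^ (i.1 : ℕ) * R i := by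
    rintro ⟨k, l⟩
    have h1 : (∑ n : Fin T, M n (k, l) * (z / z₀) ^ (n : ℕ)) =
        ∑ n ∈ Finset.range T, if (k : ℕ) ≤ n then h l (n - k) * z ^ n else 0 := by
      rw [Finset.sum_range]
      refine Finset.sum_congr rfl fun n _ => ?_
      simp only [M]
      split_ifs
      · rw [div_pow]; field_simp
      · simp
    rw [h1, sum_range_ite_le]
    simp only [R, mul_sub, Finset.mul_sum]
    have h2 : ∀ j, h l (k + j - k) * z ^ ((k : ℕ) + j) =
        z ^ (k : ℕ) * (((l : ℕ) * ω * z) ^ j / (j.factorial : ℂ)) := by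
      intro j
      simp only [h, Nat.add_sub_cancel_left, pow_add, mul_pow]
      ring
    simp only [h2]
    ring
  have hF : ∑ k, ∑ l, (c (k, l) : ℂ) * z ^ (k : ℕ) * Complex.exp ((l : ℕ) * ω * z) =
      (∑ n : Fin T, (z / z₀) ^ (n : ℕ) * ∑ i, M n i * c i) +
        ∑ i : Fin K × Fin L, c i * (z ^ (i.1 : ℕ) * R i) := by
    rw [← Fintype.sum_prod_type' (f := fun (k : Fin K) (l : Fin L) =>
      (c (k, l) : ℂ) * z ^ (k : ℕ) * Complex.exp ((l : ℕ) * ω * z))]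
    have h1 : ∑ i : Fin K × Fin L, (c i : ℂ) * z ^ (i.1 : ℕ) * Complex.exp ((i.2 : ℕ) * ω * z) =
        ∑ i : Fin K × Fin L, (c i : ℂ) * ((∑ n : Fin T, M n i * (z / z₀) ^ (n : ℕ)) +
          z ^ (i.1 : ℕ) * R i) := by
      refine Finset.sum_congr rfl fun i _ => ?_
      rw [mul_assoc, key]
    rw [h1]
    simp only [mul_add, Finset.sum_add_distrib, Finset.mul_sum]
    rw [Finset.sum_comm]
    congr 1
    refine Finset.sum_congr rfl fun n _ => Finset.sum_congr rfl fun i _ => ?_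
    ring
  rw [hF]
  refine (norm_add_le _ _).trans ?_
  rw [mul_add]
  refine add_le_add ?_ ?_
  · have h1 : ∀ n : Fin T, ‖(z / z₀) ^ (n : ℕ) * ∑ i, M n i * c i‖ ≤ 4 * (X * P) / q := by
      intro n
      rw [norm_mul, norm_pow, norm_div, Complex.norm_real, Real.norm_eq_abs, abs_of_pos hz0]
      have h2 : (‖z‖ / z₀) ^ (n : ℕ) ≤ 1 :=
        pow_le_one₀ (by positivity) ((div_le_one hz0).mpr hz)
      calc _ ≤ 1 * (4 * (X * P) / q) :=
            mul_le_mul h2 (hc n) (norm_nonneg _) zero_le_one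
        _ = _ := one_mul _
    have hqr : ((X : ℝ) + 1) ^ D' = q + 1 := by exact_mod_cast hq.symm
    have hq1 : (1 : ℝ) ≤ q := by exact_mod_cast (by omega : 1 ≤ q)
    calc _ ≤ ∑ n : Fin T, 4 * (X * P) / q :=
          (norm_sum_le _ _).trans (Finset.sum_le_sum fun n _ => h1 n)
      _ = X * P * (4 * T / q) := by simp; ring
      _ ≤ X * P * (8 * T / (X + 1) ^ D') := by
          rw [hqr]
          gcongr X * P * ?_
          rw [div_le_div_iff₀ (by positivity) (by positivity)]
          have : (0 : ℝ) ≤ T := by positivity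
          nlinarith
  · have h1 : ∀ i : Fin K × Fin L, ‖c i * (z ^ (i.1 : ℕ) * R i)‖ ≤
        X * ((z₀ * E) ^ K * Real.exp (L * ‖ω‖ * E * z₀)) * (1 / E ^ T) := by
      rintro ⟨k, l⟩
      have h2 : ‖(c (k, l) : ℂ)‖ ≤ X := by
        rw [Complex.norm_intCast]
        exact_mod_cast hcX (k, l)
      have h3 := norm_exp_sub_sum_le_pow_mul_exp ((l : ℕ) * ω * z) (T - k) hE
      have h4 : ‖((l : ℕ) : ℂ) * ω * z‖ ≤ L * ‖ω‖ * z₀ := by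
        have : ((l : ℕ) : ℝ) ≤ L := by exact_mod_cast l.2.le
        rw [norm_mul, norm_mul, Complex.norm_natCast]
        gcongr
      have h5 : ‖z‖ ^ (k : ℕ) * (E ^ (T - k))⁻¹ ≤ (z₀ * E) ^ K * (1 / E ^ T) := by
        have h6 : E ^ T ≤ E ^ (T - k) * E ^ K := by
          rw [← pow_add]
          exact pow_le_pow_right₀ hE (by have := k.2; omega)
        have h7 : ‖z‖ ^ (k : ℕ) ≤ z₀ ^ K :=
          (pow_le_pow_left₀ (norm_nonneg _) hz _).trans (pow_le_pow_right₀ hz₀ k.2.le)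
        rw [mul_pow, mul_one_div, ← div_eq_mul_inv, div_le_div_iff₀ (by positivity) (by positivity)]
        calc _ ≤ z₀ ^ K * (E ^ (T - k) * E ^ K) := by gcongr
          _ = _ := by ring
      rw [norm_mul, norm_mul, norm_pow]
      calc _ ≤ X * (‖z‖ ^ (k : ℕ) * ((E ^ (T - k))⁻¹ * Real.exp (E * ‖(l : ℕ) * ω * z‖))) := by
            gcongr
        _ = X * ((‖z‖ ^ (k : ℕ) * (E ^ (T - k))⁻¹) * Real.exp (E * ‖(l : ℕ) * ω * z‖)) := by ring
        _ ≤ X * (((z₀ * E) ^ K * (1 / E ^ T)) * Real.exp (E * (L * ‖ω‖ * z₀))) := by gcongr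
        _ = _ := by
            rw [show E * (L * ‖ω‖ * z₀) = L * ‖ω‖ * E * z₀ by ring]
            ring
    calc _ ≤ ∑ i : Fin K × Fin L, X * ((z₀ * E) ^ K * Real.exp (L * ‖ω‖ * E * z₀)) * (1 / E ^ T) :=
          (norm_sum_le _ _).trans (Finset.sum_le_sum fun i _ => h1 i)
      _ = _ := by
          simp [hP]
          ring

theorem norm_sum_sum_le {K L : ℕ} (f : Fin K → Fin L → ℂ) {Y : ℝ} (h : ∀ k l, ‖f k l‖ ≤ Y) :
    ‖∑ k, ∑ l, f k l‖ ≤ K * L * Y := by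
  calc ‖∑ k, ∑ l, f k l‖ ≤ ∑ k : Fin K, ∑ l : Fin L, Y :=
        (norm_sum_le _ _).trans (Finset.sum_le_sum fun k _ =>
          (norm_sum_le _ _).trans (Finset.sum_le_sum fun l _ => h k l))
    _ = _ := by simp; ring

theorem pow_mul_pow_le_exp {a b U : ℝ} (ha : 0 ≤ a) (hb : 0 ≤ b) (haU : a ≤ Real.exp U)
    (hbU : b ≤ Real.exp U) (hU : 0 ≤ U) {L r : ℕ} (l : Fin L) :
    a ^ (l * r : ℕ) * b ^ ((L - 1 - l) * r : ℕ) ≤ Real.exp (L * (r * U)) := by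
  calc a ^ (l * r : ℕ) * b ^ ((L - 1 - l) * r : ℕ)
      ≤ Real.exp U ^ (l * r : ℕ) * Real.exp U ^ ((L - 1 - l) * r : ℕ) := by gcongr
    _ = Real.exp (((l * r + (L - 1 - l) * r : ℕ) : ℝ) * U) := by
        rw [← pow_add, ← Real.exp_nat_mul]
    _ ≤ _ := by
        rw [Real.exp_le_exp, ← mul_assoc]
        have h1 : (l * r + (L - 1 - l) * r : ℕ) ≤ L * r := by
          rw [← add_mul]
          exact Nat.mul_le_mul_right _ (by have := l.2; omega)
        have h2 : ((l * r + (L - 1 - l) * r : ℕ) : ℝ) ≤ L * r := by exact_mod_cast h1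
        gcongr

set_option maxHeartbeats 2000000 in
/-- A lower bound for a linear form in two logarithms: if `u / w = exp ω` is not a root of unity,
then `q / p` cannot be too close to `exp (N ω)`. -/
theorem one_le_mul_norm_two_logs {F : Type*} [Field F] [NumberField F] (φ : F →+* ℂ)
    {u w p q : 𝓞 F} (hw : w ≠ 0) (hp : p ≠ 0) (hq : q ≠ 0) {U A : ℝ} (hU0 : 0 ≤ U) (hA0 : 0 ≤ A)
    (huU : ∀ τ : F →+* ℂ, ‖τ u‖ ≤ Real.exp U) (hwU : ∀ τ : F →+* ℂ, ‖τ w‖ ≤ Real.exp U)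
    (hpA : ∀ τ : F →+* ℂ, ‖τ p‖ ≤ Real.exp A) (hqA : ∀ τ : F →+* ℂ, ‖τ q‖ ≤ Real.exp A)
    {N R S K L T X : ℕ} {E : ℝ} {ω : ℂ} (hω : φ u = φ w * Complex.exp ω)
    (hη : ∀ n : ℕ, 0 < n → Complex.exp ω ^ n ≠ 1) (hRN : R ≤ N) (hLR : L ≤ R) (hS : 0 < S)
    (hcard : L * K < (R - L) * S) (hE : 1 ≤ E)
    (hT : 2 * (2 * Module.finrank ℚ F + 1) * T < K * L) (hTX : 32 * T ≤ X)
    (hET : 4 * (X : ℝ) ^ (2 * Module.finrank ℚ F) ≤ E ^ T)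
    (hX : K * L * ((R + N * S) * E) ^ K * Real.exp (L * ‖ω‖ * E * (R + N * S)) *
      Real.exp (L * (R * U + S * A)) ≤ X) :
    1 ≤ 4 * (L * S) * (X : ℝ) ^ (2 * Module.finrank ℚ F) *
      ‖φ q / φ p * Complex.exp (-(N * ω)) - 1‖ := by
  set D := Module.finrank ℚ F with hDdef
  have hDpos : 0 < D := Module.finrank_pos
  set δ : ℂ := φ q / φ p * Complex.exp (-(N * ω)) - 1 with hδ
  have hKL : 0 < K * L := by omega
  have hK : 0 < K := Nat.pos_of_mul_pos_right hKL
  have hL : 0 < L := Nat.pos_of_mul_pos_left hKL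
  have hK' : (1 : ℝ) ≤ K := by exact_mod_cast hK
  have hL' : (1 : ℝ) ≤ L := by exact_mod_cast hL
  have hS' : (1 : ℝ) ≤ S := by exact_mod_cast hS
  have hR' : (1 : ℝ) ≤ R := by exact_mod_cast (by omega : 1 ≤ R)
  have hE0 : 0 < E := by linarith
  set z₀ : ℝ := R + N * S with hz₀def
  have hz₀ : 1 ≤ z₀ := by
    have : (0 : ℝ) ≤ N * S := by positivity
    linarith
  set W : ℝ := Real.exp (L * (R * U + S * A)) with hW
  set P : ℝ := K * L * (z₀ * E) ^ K * Real.exp (L * ‖ω‖ * E * z₀) with hP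
  have hP0 : 0 < P := by positivity
  have hW0 : 0 < W := Real.exp_pos _
  have hW1 : 1 ≤ W := Real.one_le_exp (by positivity)
  have hz0E : z₀ ^ K ≤ (z₀ * E) ^ K := by gcongr; nlinarith
  have hX' : (1 : ℝ) ≤ X := by
    refine le_trans ?_ hX
    have h1 : 1 ≤ (z₀ * E) ^ K := one_le_pow₀ (by nlinarith)
    have h2 : 1 ≤ Real.exp (L * ‖ω‖ * E * z₀) := Real.one_le_exp (by positivity)
    refine one_le_mul_of_one_le_of_one_le ?_ hW1
    exact one_le_mul_of_one_le_of_one_le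
      (one_le_mul_of_one_le_of_one_le (one_le_mul_of_one_le_of_one_le hK' hL') h1) h2
  have hXpos : 0 < X := by exact_mod_cast hX'
  by_contra! hcon
  have hLS : (L * S : ℝ) * ‖δ‖ ≤ 1 := by
    have h1 : (1 : ℝ) ≤ (X : ℝ) ^ (2 * D) := one_le_pow₀ hX'
    have h2 : 0 ≤ (L * S : ℝ) * ‖δ‖ := by positivity
    nlinarith
  have hφw : φ w ≠ 0 := by simpa using hw
  have hφp : φ p ≠ 0 := by simpa using hp
  have hφq : φ q ≠ 0 := by simpa using hq
  obtain ⟨c, hc0, hcX, hc⟩ := exists_expPoly_small (T := T) (D' := 2 * D + 1) hK hL hXpos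
    (by omega) hT hz₀ hE ω
  -- a point where the polynomial does not vanish
  let Q : Fin L → Polynomial ℂ := fun l => ∑ k : Fin K, Polynomial.C (c k l : ℂ) *
    Polynomial.X ^ (k : ℕ)
  have hQ0 : Q ≠ 0 := by
    intro h
    apply hc0
    funext k l
    have h1 := congrArg (fun f => Polynomial.coeff f k) (congrFun h l)
    simp only [Q, Polynomial.finsetSum_coeff, Polynomial.coeff_C_mul_X_pow, Pi.zero_apply,
      Polynomial.coeff_zero, Fin.val_inj] at h1
    simpa using h1
  have hQK : ∀ l, (Q l).natDegree ≤ K := by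
    intro l
    refine Polynomial.natDegree_sum_le_of_forall_le _ _ fun k _ => ?_
    exact (Polynomial.natDegree_C_mul_X_pow_le _ _).trans k.2.le
  set ρ : ℂ := φ q / φ p with hρ
  have hρ0 : ρ ≠ 0 := div_ne_zero hφq hφp
  obtain ⟨⟨r, s⟩, hrs, i, hi, hne⟩ := exists_sum_eval_ne_zero Q hQ0 hQK (Complex.exp ω)
    (Complex.exp_ne_zero _) hη (Finset.range (R - L) ×ˢ Finset.range S)
    (fun a => (a.1 : ℂ) + N * a.2) (fun a => Complex.exp ω ^ a.1 * ρ ^ a.2)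
    (fun a _ => mul_ne_zero (pow_ne_zero _ (Complex.exp_ne_zero _)) (pow_ne_zero _ hρ0))
    (by
      rintro ⟨a, b⟩ hab ⟨a', b'⟩ hab' h
      simp only [Finset.coe_product, Finset.coe_range, Set.mem_prod, Set.mem_Iio] at hab hab'
      have h0 : (a : ℂ) + N * b = a' + N * b' := h
      have h1 : a + N * b = a' + N * b' := by exact_mod_cast h0
      have ha : a < N := by omega
      have ha' : a' < N := by omega
      have h2 : a = a' := by
        have := congrArg (· % N) h1
        simpa [Nat.add_mul_mod_self_left, Nat.mod_eq_of_lt ha, Nat.mod_eq_of_lt ha'] using this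
      have h3 : b = b' := by
        subst h2
        exact Nat.eq_of_mul_eq_mul_left (by omega : 0 < N) (by omega)
      rw [h2, h3])
    (by simpa using hcard)
  simp only [Finset.mem_product, Finset.mem_range] at hrs
  set r' := i + r with hr'
  have hrR₁ : r' < R := by omega
  set z : ℕ := r' + N * s with hz
  have hzz₀ : (z : ℝ) ≤ z₀ := by
    have h1 : z ≤ R + N * S := by
      have := Nat.mul_le_mul_left N hrs.2.le
      omega
    rw [hz₀def]
    exact_mod_cast h1
  have hrR₂ : (r' : ℝ) ≤ R := by exact_mod_cast hrR₁.le
  have hsS' : (s : ℝ) ≤ S := by exact_mod_cast hrs.2.le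
  let G : 𝓞 F := ∑ k : Fin K, ∑ l : Fin L, (c k l : 𝓞 F) * (z : 𝓞 F) ^ (k : ℕ) *
    (u ^ (l * r' : ℕ) * w ^ ((L - 1 - l) * r' : ℕ)) *
    (q ^ (l * s : ℕ) * p ^ ((L - 1 - l) * s : ℕ))
  have hGτ : ∀ τ : F →+* ℂ, τ G = ∑ k : Fin K, ∑ l : Fin L, (c k l : ℂ) * (z : ℂ) ^ (k : ℕ) *
      (τ u ^ (l * r' : ℕ) * τ w ^ ((L - 1 - l) * r' : ℕ)) *
      (τ q ^ (l * s : ℕ) * τ p ^ ((L - 1 - l) * s : ℕ)) := by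
    intro τ
    simp [G, map_sum]
  have hWrs : Real.exp (L * (r' * U)) * Real.exp (L * (s * A)) ≤ W := by
    rw [← Real.exp_add, hW, Real.exp_le_exp, ← mul_add]
    gcongr
  have hGbound : ∀ τ : F →+* ℂ, ‖τ G‖ ≤ (X : ℝ) ^ 2 := by
    intro τ
    rw [hGτ]
    refine (norm_sum_sum_le (Y := X * z₀ ^ K * W) _ fun k l => ?_).trans ?_
    · rw [norm_mul, norm_mul, norm_mul, norm_mul, norm_mul]
      simp only [norm_pow]
      rw [Complex.norm_intCast, Complex.norm_natCast, mul_assoc]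
      have h1 : |((c k l : ℤ) : ℝ)| ≤ X := by exact_mod_cast hcX k l
      have h2 : (z : ℝ) ^ (k : ℕ) ≤ z₀ ^ K :=
        (pow_le_pow_left₀ (by positivity) hzz₀ _).trans (pow_le_pow_right₀ hz₀ k.2.le)
      have h3 := pow_mul_pow_le_exp (norm_nonneg _) (norm_nonneg _) (huU τ) (hwU τ) hU0
        (r := r') l
      have h4 := pow_mul_pow_le_exp (norm_nonneg _) (norm_nonneg _) (hqA τ) (hpA τ) hA0
        (r := s) l
      refine mul_le_mul (mul_le_mul h1 h2 (by positivity) (by positivity)) ?_ (by positivity)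
        (by positivity)
      exact (mul_le_mul h3 h4 (by positivity) (by positivity)).trans hWrs
    · have h5 : K * L * z₀ ^ K * W ≤ X := by
        refine le_trans ?_ hX
        gcongr
        rw [hP]
        have h2 : 1 ≤ Real.exp (L * ‖ω‖ * E * z₀) := Real.one_le_exp (by positivity)
        calc (K : ℝ) * L * z₀ ^ K = K * L * z₀ ^ K * 1 := (mul_one _).symm
          _ ≤ _ := by gcongr
      calc K * L * (X * z₀ ^ K * W) = X * (K * L * z₀ ^ K * W) := by ring
        _ ≤ X * X := by gcongr
        _ = _ := by ring
  have hexp : ρ = Complex.exp (N * ω) * (1 + δ) := by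
    rw [hδ, add_sub_cancel, mul_comm ρ, ← mul_assoc, ← Complex.exp_add]
    simp
  have hterm : ∀ l : Fin L, (Complex.exp ω ^ r' * ρ ^ s) ^ (l : ℕ) =
      Complex.exp ((l : ℕ) * ω * z) * (1 + δ) ^ (s * l : ℕ) := by
    intro l
    rw [hexp, mul_pow, mul_pow, mul_pow, ← pow_mul (1 + δ)]
    simp only [← Complex.exp_nat_mul]
    rw [← mul_assoc, ← Complex.exp_add]
    congr 2
    simp only [hz, Nat.cast_add, Nat.cast_mul]
    ring
  have hφG : φ G = (φ w ^ ((L - 1) * r') * φ p ^ ((L - 1) * s)) *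
      ∑ k : Fin K, ∑ l : Fin L, (c k l : ℂ) * (z : ℂ) ^ (k : ℕ) *
        (Complex.exp ω ^ r' * ρ ^ s) ^ (l : ℕ) := by
    rw [hGτ, Finset.mul_sum]
    refine Finset.sum_congr rfl fun k _ => ?_
    rw [Finset.mul_sum]
    refine Finset.sum_congr rfl fun l _ => ?_
    have hpq : φ q = φ p * ρ := by rw [hρ]; field_simp
    have h1 : (L - 1) * r' = l * r' + (L - 1 - l) * r' := by
      rw [← add_mul]; congr 1; have := l.2; omega
    have h2 : (L - 1) * s = l * s + (L - 1 - l) * s := by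
      rw [← add_mul]; congr 1; have := l.2; omega
    rw [h1, h2, hω, hpq]
    simp only [mul_pow, pow_add, ← pow_mul]
    rw [mul_comm r' (l : ℕ), mul_comm s (l : ℕ)]
    ring
  have hφG0 : φ G ≠ 0 := by
    rw [hφG]
    refine mul_ne_zero (mul_ne_zero (pow_ne_zero _ hφw) (pow_ne_zero _ hφp)) ?_
    rw [Finset.sum_comm]
    convert hne using 2 with l _
    simp only [Q, Polynomial.eval_finsetSum, Polynomial.eval_mul, Polynomial.eval_C,
      Polynomial.eval_pow, Polynomial.eval_X]
    rw [Finset.sum_mul]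
    refine Finset.sum_congr rfl fun k _ => ?_
    congr 1
    · congr 2
      simp only [hz, hr', Nat.cast_add, Nat.cast_mul]
      ring
    · rw [hr', pow_add, mul_assoc]
  have hG0 : G ≠ 0 := by
    intro h
    apply hφG0
    rw [h]
    simp
  -- the upper bound at `φ`
  have hsmall : ‖∑ k : Fin K, ∑ l : Fin L, (c k l : ℂ) * (z : ℂ) ^ (k : ℕ) *
        (Complex.exp ω ^ r' * ρ ^ s) ^ (l : ℕ)‖ ≤
      X * P * (8 * T / (X + 1) ^ (2 * D + 1) + 1 / E ^ T + 2 * (L * S * ‖δ‖)) := by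
    have h1 := hc z (by rw [Complex.norm_natCast]; exact hzz₀)
    have h2 : ∑ k : Fin K, ∑ l : Fin L, (c k l : ℂ) * (z : ℂ) ^ (k : ℕ) *
        (Complex.exp ω ^ r' * ρ ^ s) ^ (l : ℕ) =
        ∑ k : Fin K, ∑ l : Fin L, (c k l : ℂ) * (z : ℂ) ^ (k : ℕ) *
          Complex.exp ((l : ℕ) * ω * z) +
        ∑ k : Fin K, ∑ l : Fin L, (c k l : ℂ) * (z : ℂ) ^ (k : ℕ) *
          Complex.exp ((l : ℕ) * ω * z) * ((1 + δ) ^ (s * l : ℕ) - 1) := by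
      rw [← Finset.sum_add_distrib]
      refine Finset.sum_congr rfl fun k _ => ?_
      rw [← Finset.sum_add_distrib]
      refine Finset.sum_congr rfl fun l _ => ?_
      rw [hterm]
      ring
    rw [h2, mul_add (X * P)]
    refine (norm_add_le _ _).trans (add_le_add h1 ?_)
    refine (norm_sum_sum_le (Y := X * (z₀ * E) ^ K * Real.exp (L * ‖ω‖ * E * z₀) *
      (2 * (L * S * ‖δ‖))) _ fun k l => ?_).trans (le_of_eq (by rw [hP]; ring))
    rw [norm_mul, norm_mul, norm_mul, norm_pow, Complex.norm_intCast, Complex.norm_natCast]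
    have h3 : |((c k l : ℤ) : ℝ)| ≤ X := by exact_mod_cast hcX k l
    have h4 : (z : ℝ) ^ (k : ℕ) ≤ (z₀ * E) ^ K :=
      ((pow_le_pow_left₀ (by positivity) hzz₀ _).trans (pow_le_pow_right₀ hz₀ k.2.le)).trans hz0E
    have hlL : ((l : ℕ) : ℝ) ≤ L := by exact_mod_cast l.2.le
    have h5 : ‖Complex.exp ((l : ℕ) * ω * z)‖ ≤ Real.exp (L * ‖ω‖ * E * z₀) := by
      refine (Complex.norm_exp_le_exp_norm _).trans ?_
      rw [Real.exp_le_exp, norm_mul, norm_mul, Complex.norm_natCast, Complex.norm_natCast]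
      calc (l : ℕ) * ‖ω‖ * z ≤ L * ‖ω‖ * z₀ := by gcongr
        _ ≤ _ := by
          have : 0 ≤ L * ‖ω‖ * z₀ := by positivity
          nlinarith
    have hsl : ((s * l : ℕ) : ℝ) * ‖δ‖ ≤ L * S * ‖δ‖ := by
      push_cast
      rw [mul_comm (L : ℝ)]
      gcongr
    have h6 := norm_one_add_pow_sub_one_le δ (s * l) (hsl.trans hLS)
    have h7 : ‖(1 + δ) ^ (s * l : ℕ) - 1‖ ≤ 2 * (L * S * ‖δ‖) := by linarith
    exact mul_le_mul (mul_le_mul (mul_le_mul h3 h4 (by positivity) (by positivity)) h5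
      (norm_nonneg _) (by positivity)) h7 (norm_nonneg _) (by positivity)
  have hWφ : ‖φ w ^ ((L - 1) * r') * φ p ^ ((L - 1) * s)‖ ≤ W := by
    rw [norm_mul, norm_pow, norm_pow]
    have h3 := pow_mul_pow_le_exp (norm_nonneg _) (norm_nonneg _) (hwU φ) (hwU φ) hU0
      (r := r') (⟨0, hL⟩ : Fin L)
    have h4 := pow_mul_pow_le_exp (norm_nonneg _) (norm_nonneg _) (hpA φ) (hpA φ) hA0
      (r := s) (⟨0, hL⟩ : Fin L)
    simp only [Nat.sub_zero, zero_mul, pow_zero, one_mul] at h3 h4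
    exact (mul_le_mul h3 h4 (by positivity) (by positivity)).trans hWrs
  have hφGle : ‖φ G‖ ≤ (X : ℝ) ^ 2 *
      (8 * T / (X + 1) ^ (2 * D + 1) + 1 / E ^ T + 2 * (L * S * ‖δ‖)) := by
    rw [hφG, norm_mul]
    calc _ ≤ W * (X * P * (8 * T / (X + 1) ^ (2 * D + 1) + 1 / E ^ T + 2 * (L * S * ‖δ‖))) :=
          mul_le_mul hWφ hsmall (norm_nonneg _) hW0.le
      _ = X * (P * W) * (8 * T / (X + 1) ^ (2 * D + 1) + 1 / E ^ T + 2 * (L * S * ‖δ‖)) := by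
          ring
      _ ≤ X * X * (8 * T / (X + 1) ^ (2 * D + 1) + 1 / E ^ T + 2 * (L * S * ‖δ‖)) := by
          gcongr
      _ = _ := by ring
  have hliou := one_le_norm_mul_pow φ G hG0 hGbound
  rw [← hDdef] at hliou
  have hfin : (1 : ℝ) ≤ (X : ℝ) ^ (2 * D) *
      (8 * T / (X + 1) ^ (2 * D + 1) + 1 / E ^ T + 2 * (L * S * ‖δ‖)) := by
    refine hliou.trans ((mul_le_mul_of_nonneg_right hφGle (by positivity)).trans (le_of_eq ?_))
    have : (X : ℝ) ^ (2 * D) = X ^ 2 * (X ^ 2) ^ (D - 1) := by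
      rw [← pow_mul, ← pow_add]; congr 1; omega
    rw [this]
    ring
  have hXD : (0 : ℝ) < (X : ℝ) ^ (2 * D) := by positivity
  have h1 : (X : ℝ) ^ (2 * D) * (8 * T / (X + 1) ^ (2 * D + 1)) ≤ 1 / 4 := by
    rw [← mul_div_assoc, div_le_iff₀ (by positivity), pow_succ]
    have h2 : (X : ℝ) ^ (2 * D) ≤ (X + 1) ^ (2 * D) := by gcongr; linarith
    have h3 : 32 * (T : ℝ) ≤ X + 1 := by
      have : 32 * (T : ℝ) ≤ X := by exact_mod_cast hTX
      linarith
    have h4 := mul_le_mul h2 h3 (by positivity) (by positivity)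
    linarith
  have h2 : (X : ℝ) ^ (2 * D) * (1 / E ^ T) ≤ 1 / 4 := by
    rw [mul_one_div, div_le_iff₀ (by positivity)]
    linarith
  rw [mul_add, mul_add] at hfin
  linarith

open scoped Classical in
theorem exists_ne_zero_place_lt {K : Type*} [Field K] [NumberField K]
    (f : InfinitePlace K → ℝ) (hf : ∀ w, 0 ≤ f w)
    (h : √|(discr K : ℝ)| < ∏ w, f w ^ w.mult) :
    ∃ a : 𝓞 K, a ≠ 0 ∧ ∀ w : InfinitePlace K, w (a : K) < f w := by
  let g : InfinitePlace K → NNReal := fun w => ⟨f w, hf w⟩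
  have key : mixedEmbedding.minkowskiBound K 1 < MeasureTheory.volume
      (mixedEmbedding.convexBodyLT K g) := by
    rw [mixedEmbedding.convexBodyLT_volume, mixedEmbedding.minkowskiBound,
      mixedEmbedding.volume_fundamentalDomain_fractionalIdealLatticeBasis,
      mixedEmbedding.volume_fundamentalDomain_latticeBasis, mixedEmbedding.finrank,
      ← InfinitePlace.card_add_two_mul_card_eq_rank]
    simp only [Units.val_one, map_one, Rat.cast_one, ENNReal.ofReal_one, one_mul]
    rw [← ENNReal.coe_ofNat (2 : ℕ), ← ENNReal.coe_inv two_ne_zero]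
    norm_cast
    rw [← NNReal.coe_lt_coe]
    push_cast
    have h2 : ∏ w, (g w : ℝ) ^ w.mult = ∏ w, f w ^ w.mult := rfl
    rw [h2, Int.norm_eq_abs]
    set s := InfinitePlace.nrComplexPlaces K
    have h3 : (2⁻¹ : ℝ) ^ s * √|(discr K : ℝ)| *
        2 ^ (InfinitePlace.nrRealPlaces K + 2 * s) =
        2 ^ InfinitePlace.nrRealPlaces K * 2 ^ s * √|(discr K : ℝ)| := by
      rw [pow_add, two_mul, pow_add, inv_pow]
      field_simp
    refine h3.trans_lt ?_
    exact mul_lt_mul' (by gcongr; exact Real.two_le_pi) h (by positivity)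
      (mul_pos (by positivity) (pow_pos Real.pi_pos _))
  obtain ⟨a, ha, hlt⟩ := mixedEmbedding.exists_ne_zero_mem_ringOfIntegers_lt K key
  exact ⟨a, ha, hlt⟩

theorem exists_norm_le_mul_rpow {K : Type*} [Field K] [NumberField K] {c : ℝ} (hc : 0 ≤ c)
    (hdisc : √|(discr K : ℝ)| < c ^ Module.finrank ℚ K) {β : 𝓞 K} (hβ : β ≠ 0) {t : ℝ}
    (ht : 0 ≤ t) :
    ∃ b : 𝓞 K, b ≠ 0 ∧ ∀ σ : K →+* ℂ, ‖σ b‖ ≤ c * ‖σ β‖ ^ t := by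
  obtain ⟨b, hb, h⟩ := exists_ne_zero_place_lt (K := K) (fun w => c * w (β : K) ^ t)
    (fun w => by positivity) (by
      refine hdisc.trans_le ?_
      simp only [mul_pow]
      rw [Finset.prod_mul_distrib, Finset.prod_pow_eq_pow_sum, InfinitePlace.sum_mult_eq]
      refine le_mul_of_one_le_right (by positivity) ?_
      have h1 : ∏ w : InfinitePlace K, (w (β : K) ^ t) ^ w.mult =
          (∏ w : InfinitePlace K, w (β : K) ^ w.mult) ^ t := by
        rw [← Real.finsetProd_rpow _ _ (fun w _ => by positivity)]
        refine Finset.prod_congr rfl fun w _ => ?_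
        rw [← Real.rpow_natCast, ← Real.rpow_mul (by positivity), mul_comm, Real.rpow_mul
          (by positivity), Real.rpow_natCast]
      rw [h1, InfinitePlace.prod_eq_abs_norm]
      refine Real.one_le_rpow ?_ ht
      have h2 : Algebra.norm ℤ β ≠ 0 := Algebra.norm_ne_zero_iff.mpr hβ
      have h3 : 1 ≤ |Algebra.norm ℤ β| := Int.one_le_abs h2
      rw [← Algebra.coe_norm_int]
      exact_mod_cast h3)
  refine ⟨b, hb, fun σ => ?_⟩
  have := (h (InfinitePlace.mk σ)).le
  simpa [InfinitePlace.apply] using this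

open scoped Classical in
theorem sqrt_abs_discr_le {K : Type*} [Field K] [NumberField K] (θ : 𝓞 K) {Y : ℝ} (hY1 : 1 ≤ Y)
    (hinj : ∀ σ τ : K →+* ℂ, σ θ = τ θ → σ = τ) (hY : ∀ σ : K →+* ℂ, ‖σ θ‖ ≤ Y) :
    √|(discr K : ℝ)| ≤ (Module.finrank ℚ K).factorial * Y ^ (Module.finrank ℚ K ^ 2) := by
  set d := Module.finrank ℚ K with hd
  let ι := Module.Free.ChooseBasisIndex ℤ (𝓞 K)
  have hι : Fintype.card ι = d := by
    rw [hd, Module.finrank_eq_card_basis (integralBasis K)]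
  let e : ι ≃ Fin d := Fintype.equivFinOfCardEq hι
  have hA : Fintype.card (K →ₐ[ℚ] ℂ) = d := AlgHom.card ℚ K ℂ
  let e' : Fin d ≃ (K →ₐ[ℚ] ℂ) := (Fintype.equivFinOfCardEq hA).symm
  let b : ι → K := fun i => (θ : K) ^ (e i : ℕ)
  have h1 := Algebra.discr_eq_det_embeddingsMatrixReindex_pow_two ℚ ℂ b (e.trans e')
  set D := (Algebra.embeddingsMatrixReindex ℚ ℂ b (e.trans e')).det with hDdef
  have hent : ∀ i j, Algebra.embeddingsMatrixReindex ℚ ℂ b (e.trans e') i j =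
      e' (e j) θ ^ (e i : ℕ) := by
    intro i j
    simp [Algebra.embeddingsMatrixReindex, Algebra.embeddingsMatrix, b]
  have hD0 : D ≠ 0 := by
    have h2 : Algebra.embeddingsMatrixReindex ℚ ℂ b (e.trans e') =
        ((Matrix.vandermonde fun j => e' j θ).transpose).submatrix e e := by
      ext i j
      rw [hent]
      simp [Matrix.vandermonde]
    rw [hDdef, h2, Matrix.det_submatrix_equiv_self, Matrix.det_transpose,
      Matrix.det_vandermonde_ne_zero_iff]
    intro i j hij
    apply e'.injective
    have := hinj (e' i).toRingHom (e' j).toRingHom hij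
    ext x
    exact congrArg (fun f : K →+* ℂ => f x) this
  have hDle : ‖D‖ ≤ d.factorial * Y ^ (d ^ 2) := by
    have h3 := Matrix.det_le (abv := NormedField.toAbsoluteValue ℂ)
      (A := Algebra.embeddingsMatrixReindex ℚ ℂ b (e.trans e')) (x := Y ^ d) (by
        intro i j
        rw [hent]
        change ‖(e' (e j) θ ^ (e i : ℕ) : ℂ)‖ ≤ _
        rw [norm_pow]
        calc _ ≤ Y ^ (e i : ℕ) := by gcongr; exact hY (e' (e j)).toRingHom
          _ ≤ _ := pow_le_pow_right₀ hY1 (e i).2.le)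
    rw [hι, nsmul_eq_mul, ← pow_mul, ← sq] at h3
    exact h3
  let P : Matrix ι ι ℤ := fun i j => (RingOfIntegers.basis K).repr (θ ^ (e j : ℕ)) i
  have hP : (integralBasis K).toMatrix b = P.map (Int.castRingHom ℚ) := by
    ext i j
    rw [Module.Basis.toMatrix_apply]
    have := integralBasis_repr_apply K (θ ^ (e j : ℕ)) i
    simp only [b, P]
    rw [← map_pow]
    exact this
  have h4 : Algebra.discr ℚ b = (P.det : ℚ) ^ 2 * discr K := by
    have h5 := Algebra.discr_of_matrix_vecMul (integralBasis K) ((integralBasis K).toMatrix b)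
    rw [Module.Basis.toMatrix_map_vecMul, ← coe_discr, hP] at h5
    rw [h5]
    congr 2
    exact (RingHom.map_det (Int.castRingHom ℚ) P).symm
  have h6 : ((P.det : ℂ) ^ 2) * (discr K : ℂ) = D ^ 2 := by
    rw [← h1, h4]
    simp
  have hP0 : P.det ≠ 0 := by
    intro h
    rw [h] at h6
    simp only [Int.cast_zero, ne_eq, OfNat.ofNat_ne_zero, not_false_eq_true, zero_pow,
      zero_mul] at h6
    exact pow_ne_zero 2 hD0 h6.symm
  have h7 : |(discr K : ℝ)| ≤ ‖D‖ ^ 2 := by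
    rw [← norm_pow, ← h6, norm_mul, norm_pow, Complex.norm_intCast, Complex.norm_intCast]
    refine le_mul_of_one_le_left (abs_nonneg _) (one_le_pow₀ ?_)
    exact_mod_cast Int.one_le_abs hP0
  calc √|(discr K : ℝ)| ≤ √(‖D‖ ^ 2) := Real.sqrt_le_sqrt h7
    _ = ‖D‖ := Real.sqrt_sq (norm_nonneg _)
    _ ≤ _ := hDle

theorem associated_of_repr_emod_eq {K : Type*} [Field K] [NumberField K] {a b : 𝓞 K}
    (hn : Ideal.absNorm (Ideal.span {a}) = Ideal.absNorm (Ideal.span {b}))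
    (h : ∀ i, (RingOfIntegers.basis K).repr a i % (Ideal.absNorm (Ideal.span {a}) : ℤ) =
      (RingOfIntegers.basis K).repr b i % (Ideal.absNorm (Ideal.span {a}) : ℤ)) :
    Associated a b := by
  set n := Ideal.absNorm (Ideal.span {a}) with hnd
  have han : a ∣ (n : 𝓞 K) := Ideal.mem_span_singleton.mp (Ideal.absNorm_mem _)
  have hbn : b ∣ (n : 𝓞 K) := by
    rw [hn]
    exact Ideal.mem_span_singleton.mp (Ideal.absNorm_mem _)
  have key : (n : 𝓞 K) ∣ b - a := by
    choose x hx using fun i => Int.ModEq.dvd (h i)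
    refine ⟨∑ i, x i • RingOfIntegers.basis K i, ?_⟩
    apply (RingOfIntegers.basis K).repr.injective
    ext i
    have : (n : 𝓞 K) * ∑ i, x i • RingOfIntegers.basis K i =
        (n : ℤ) • ∑ i, x i • RingOfIntegers.basis K i := by
      rw [zsmul_eq_mul]; simp
    rw [this, map_sub, map_smul, Finsupp.sub_apply, Finsupp.smul_apply,
      Module.Basis.repr_sum_self, hx i, smul_eq_mul]
  exact associated_of_dvd_dvd ((dvd_sub_self_right).mp (han.trans key))
    ((dvd_sub_self_left).mp (hbn.trans key))

theorem exists_norm_and_log_bounds {K : Type*} [Field K] [NumberField K] {c : ℝ} (hc : 1 ≤ c)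
    (hdisc : √|(discr K : ℝ)| < c ^ Module.finrank ℚ K) {β : 𝓞 K} (hβ : β ≠ 0) {t : ℝ}
    (ht : 0 ≤ t) (htN : t * Real.log |(Algebra.norm ℤ β : ℝ)| ≤ 1) :
    ∃ b : 𝓞 K, b ≠ 0 ∧ (|(Algebra.norm ℤ b : ℝ)| ≤ 3 * c ^ Module.finrank ℚ K) ∧
      ∀ σ : K →+* ℂ, |Real.log ‖σ b‖ - t * Real.log ‖σ β‖| ≤
        Module.finrank ℚ K * Real.log c + 1 := by
  classical
  obtain ⟨b, hb, h⟩ := exists_norm_le_mul_rpow (zero_le_one.trans hc) hdisc hβ ht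
  set d := Module.finrank ℚ K with hd
  have hcard : Fintype.card (K →+* ℂ) = d := Embeddings.card K ℂ
  have hc0 : 0 < c := by linarith
  have hσ0 : ∀ {x : 𝓞 K}, x ≠ 0 → ∀ σ : K →+* ℂ, 0 < ‖σ x‖ := by
    intro x hx σ
    simpa using hx
  have hle : ∀ σ : K →+* ℂ, Real.log ‖σ b‖ - t * Real.log ‖σ β‖ ≤ Real.log c := by
    intro σ
    have h1 := Real.log_le_log (hσ0 hb σ) (h σ)
    rw [Real.log_mul hc0.ne' (Real.rpow_pos_of_pos (hσ0 hβ σ) _).ne',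
      Real.log_rpow (hσ0 hβ σ)] at h1
    linarith
  have hlogN : ∀ {x : 𝓞 K}, x ≠ 0 →
      ∑ σ : K →+* ℂ, Real.log ‖σ x‖ = Real.log |(Algebra.norm ℤ x : ℝ)| := by
    intro x hx
    rw [← Real.log_prod (fun σ _ => (hσ0 hx σ).ne'), prod_norm_embeddings_eq]
    congr 1
    rw [Nat.cast_natAbs, Int.cast_abs]
  have hN1 : ∀ {x : 𝓞 K}, x ≠ 0 → 1 ≤ |(Algebra.norm ℤ x : ℝ)| := by
    intro x hx
    exact_mod_cast Int.one_le_abs (Algebra.norm_ne_zero_iff.mpr hx)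
  have hsum : ∑ σ : K →+* ℂ, (Real.log ‖σ b‖ - t * Real.log ‖σ β‖) =
      Real.log |(Algebra.norm ℤ b : ℝ)| - t * Real.log |(Algebra.norm ℤ β : ℝ)| := by
    rw [Finset.sum_sub_distrib, ← Finset.mul_sum, hlogN hb, hlogN hβ]
  refine ⟨b, hb, ?_, fun σ => ?_⟩
  · have h1 := Finset.sum_le_sum (s := Finset.univ) fun σ _ => hle σ
    rw [hsum, Finset.sum_const, Finset.card_univ, hcard, nsmul_eq_mul] at h1
    have h2 : Real.log |(Algebra.norm ℤ b : ℝ)| ≤ Real.log (Real.exp 1 * c ^ d) := by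
      rw [Real.log_mul (Real.exp_pos _).ne' (by positivity), Real.log_exp, Real.log_pow]
      linarith
    have h3 := (Real.log_le_log_iff (by have := hN1 hb; linarith) (by positivity)).mp h2
    refine h3.trans ?_
    gcongr
    exact Real.exp_one_lt_three.le
  · have hlc : 0 ≤ Real.log c := Real.log_nonneg hc
    have hd1 : (1 : ℝ) ≤ d := by exact_mod_cast (Module.finrank_pos : 0 < Module.finrank ℚ K)
    rw [abs_le]
    constructor
    · have h1 : ∑ σ ∈ Finset.univ.erase σ, (Real.log ‖σ b‖ - t * Real.log ‖σ β‖) ≤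
          (d - 1) * Real.log c := by
        refine (Finset.sum_le_sum fun σ _ => hle σ).trans (le_of_eq ?_)
        rw [Finset.sum_const, Finset.card_erase_of_mem (Finset.mem_univ _), Finset.card_univ,
          hcard, nsmul_eq_mul, Nat.cast_sub (by exact_mod_cast hd1), Nat.cast_one]
      have h2 := Finset.add_sum_erase Finset.univ
        (fun σ : K →+* ℂ => Real.log ‖σ b‖ - t * Real.log ‖σ β‖) (Finset.mem_univ σ)
      rw [hsum] at h2
      have h3 := Real.log_nonneg (hN1 hb)
      nlinarith
    · nlinarith [hle σ]

/-- By the box principle there is a unit all of whose conjugates are prescribed, up to a small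
error, by a small power of `β`. -/
theorem exists_unit_approx {K : Type*} [Field K] [NumberField K] {c : ℝ} (hc : 1 ≤ c)
    (hdisc : √|(discr K : ℝ)| < c ^ Module.finrank ℚ K) {β : 𝓞 K} (hβ : β ≠ 0)
    (σ₂ σ₃ : K →+* ℂ) {B : ℝ} (hB : 0 < B) {J M q : ℕ}
    (hJ : J * Real.log |(Algebra.norm ℤ β : ℝ)| ≤ B) (hM : 3 * c ^ Module.finrank ℚ K ≤ M)
    (hq : 0 < q)
    (hcard : (M + 1) ^ (Module.finrank ℚ K + 1) * (q + 1) ^ (Module.finrank ℚ K + 1) ≤ J)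
    {ε : ℝ} (hε : 2 * (Module.finrank ℚ K * Real.log c + 5) ≤ ε * q) :
    ∃ s : ℝ, 1 / B ≤ s ∧ s ≤ J / B ∧ ∃ g : (𝓞 K)ˣ,
      (∀ σ : K →+* ℂ, |Real.log ‖σ (g : 𝓞 K)‖ - s * Real.log ‖σ β‖| ≤ ε) ∧
      ∃ ω : ℂ, σ₃ (g : 𝓞 K) = σ₂ (g : 𝓞 K) * Complex.exp ω ∧ |ω.im| ≤ ε ∧
        ω.re = Real.log ‖σ₃ (g : 𝓞 K)‖ - Real.log ‖σ₂ (g : 𝓞 K)‖ := by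
  classical
  set d := Module.finrank ℚ K with hd
  have hcardE : Fintype.card (K →+* ℂ) = d := Embeddings.card K ℂ
  have hcardι : Fintype.card (Module.Free.ChooseBasisIndex ℤ (𝓞 K)) = d := by
    rw [hd, Module.finrank_eq_card_basis (integralBasis K)]
  have hq0 : (0 : ℝ) < q := by exact_mod_cast hq
  have hb : ∀ j : Fin (J + 1), ∃ b : 𝓞 K, b ≠ 0 ∧ (|(Algebra.norm ℤ b : ℝ)| ≤ 3 * c ^ d) ∧
      ∀ σ : K →+* ℂ, |Real.log ‖σ b‖ - (j : ℕ) / B * Real.log ‖σ β‖| ≤ d * Real.log c + 1 := by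
    intro j
    refine exists_norm_and_log_bounds hc hdisc hβ (by positivity) ?_
    rw [div_mul_eq_mul_div, div_le_one hB]
    refine le_trans ?_ hJ
    have : ((j : ℕ) : ℝ) ≤ J := by exact_mod_cast Nat.lt_succ_iff.mp j.2
    refine mul_le_mul_of_nonneg_right this (Real.log_nonneg ?_)
    exact_mod_cast Int.one_le_abs (Algebra.norm_ne_zero_iff.mpr hβ)
  choose b hb0 hbN hbσ using hb
  have hlc : 0 ≤ Real.log c := Real.log_nonneg hc
  set W : ℝ := d * Real.log c + 5 with hW
  have hW5 : 5 ≤ W := by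
    have : 0 ≤ d * Real.log c := by positivity
    linarith
  have hW0 : 0 < W := by linarith
  have hWε : 2 * W / q ≤ ε := by rwa [div_le_iff₀ hq0]
  let e : Fin (J + 1) → (K →+* ℂ) → ℝ := fun j σ =>
    Real.log ‖σ (b j)‖ - (j : ℕ) / B * Real.log ‖σ β‖
  let a : Fin (J + 1) → ℝ := fun j => Complex.arg (σ₃ (b j) / σ₂ (b j))
  have he : ∀ j σ, |e j σ| ≤ W := fun j σ => (hbσ j σ).trans (by linarith)
  have ha : ∀ j, |a j| ≤ W := fun j =>
    (Complex.abs_arg_le_pi _).trans (by linarith [Real.pi_le_four])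
  let n : Fin (J + 1) → ℕ := fun j => Ideal.absNorm (Ideal.span {b j})
  have hn0 : ∀ j, 0 < n j := by
    intro j
    rw [Nat.pos_iff_ne_zero]
    simp only [n, ne_eq, Ideal.absNorm_eq_zero_iff, Ideal.span_singleton_eq_bot]
    exact hb0 j
  have hnM : ∀ j, n j ≤ M := by
    intro j
    have h1 := (hbN j).trans hM
    simp only [n, Ideal.absNorm_span_singleton]
    rw [← Int.cast_abs, Int.abs_eq_natAbs] at h1
    exact_mod_cast h1
  let key : Fin (J + 1) → Fin (M + 1) × (Module.Free.ChooseBasisIndex ℤ (𝓞 K) → Fin (M + 1)) ×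
      ((K →+* ℂ) → Fin (q + 1)) × Fin (q + 1) := fun j =>
    (⟨n j, Nat.lt_succ_iff.mpr (hnM j)⟩,
      fun i => ⟨((RingOfIntegers.basis K).repr (b j) i % (n j : ℤ)).toNat, by
        have h1 := Int.emod_lt_of_pos ((RingOfIntegers.basis K).repr (b j) i)
          (by exact_mod_cast hn0 j : (0 : ℤ) < n j)
        have h2 := hnM j
        omega⟩,
      fun σ => ⟨_, floor_cell_le hW0 (q := q) (he j σ)⟩, ⟨_, floor_cell_le hW0 (q := q) (ha j)⟩)
  obtain ⟨j₁, j₂, hne, hkey⟩ := Fintype.exists_ne_map_eq_of_card_lt key (by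
    simp only [Fintype.card_prod, Fintype.card_fun, Fintype.card_fin, hcardE, hcardι]
    refine lt_of_le_of_lt (le_of_eq ?_) (Nat.lt_succ_of_le hcard)
    ring)
  wlog hlt : j₁ < j₂ generalizing j₁ j₂
  · exact this j₂ j₁ hne.symm hkey.symm (lt_of_le_of_ne (not_lt.mp hlt) hne.symm)
  simp only [key, Prod.mk.injEq, Fin.mk.injEq, funext_iff] at hkey
  obtain ⟨hkn, hki, hke, hka⟩ := hkey
  have hass : Associated (b j₁) (b j₂) := by
    refine associated_of_repr_emod_eq hkn fun i => ?_
    have h1 := hki i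
    rw [← hkn] at h1
    have h0 : (n j₁ : ℤ) ≠ 0 := by exact_mod_cast (hn0 j₁).ne'
    have h2 := Int.emod_nonneg ((RingOfIntegers.basis K).repr (b j₁) i) h0
    have h3 := Int.emod_nonneg ((RingOfIntegers.basis K).repr (b j₂) i) h0
    simp only [n] at h1 h2 h3
    omega
  obtain ⟨g, hg⟩ := hass
  have hσ0 : ∀ {x : 𝓞 K}, x ≠ 0 → ∀ σ : K →+* ℂ, σ x ≠ 0 := by
    intro x hx σ
    simpa using hx
  have hgσ : ∀ σ : K →+* ℂ, σ (b j₂) = σ (b j₁) * σ (g : 𝓞 K) := by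
    intro σ
    rw [← hg]
    simp
  have hlog : ∀ σ : K →+* ℂ, Real.log ‖σ (g : 𝓞 K)‖ = Real.log ‖σ (b j₂)‖ -
      Real.log ‖σ (b j₁)‖ := by
    intro σ
    rw [hgσ, norm_mul, Real.log_mul]
    · ring
    · simpa using hb0 j₁
    · simp
  have hlt' : ((j₁ : ℕ) : ℝ) + 1 ≤ (j₂ : ℕ) := by exact_mod_cast hlt
  have hj₂ : ((j₂ : ℕ) : ℝ) ≤ J := by exact_mod_cast Nat.lt_succ_iff.mp j₂.2
  refine ⟨((j₂ : ℕ) - (j₁ : ℕ)) / B, ?_, ?_, g, fun σ => ?_,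
    Complex.log (σ₃ (b j₂) / σ₂ (b j₂)) - Complex.log (σ₃ (b j₁) / σ₂ (b j₁)), ?_, ?_, ?_⟩
  · gcongr; linarith
  · gcongr
    have : (0 : ℝ) ≤ (j₁ : ℕ) := by positivity
    linarith
  · have h1 := abs_sub_le_of_floor_eq hW0 hq (he j₂ σ) (he j₁ σ) (hke σ).symm
    refine le_trans (le_of_eq ?_) (h1.trans hWε)
    rw [hlog]
    congr 1
    simp only [e]
    ring
  · have h1 := hσ0 (hb0 j₁)
    have h2 := hσ0 (hb0 j₂)
    rw [Complex.exp_sub, Complex.exp_log (div_ne_zero (h2 _) (h2 _)),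
      Complex.exp_log (div_ne_zero (h1 _) (h1 _))]
    have h3 := h2 σ₂
    rw [hgσ] at h3 ⊢
    rw [hgσ]
    have h4 := h1 σ₂
    have h5 := h1 σ₃
    have h6 := right_ne_zero_of_mul h3
    field_simp
  · rw [Complex.sub_im, Complex.log_im, Complex.log_im]
    exact (abs_sub_le_of_floor_eq hW0 hq (ha j₂) (ha j₁) hka.symm).trans hWε
  · have h1 := hσ0 (hb0 j₁)
    have h2 := hσ0 (hb0 j₂)
    rw [Complex.sub_re, Complex.log_re, Complex.log_re, norm_div, norm_div,
      Real.log_div (norm_ne_zero_iff.mpr (h2 _)) (norm_ne_zero_iff.mpr (h2 _)),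
      Real.log_div (norm_ne_zero_iff.mpr (h1 _)) (norm_ne_zero_iff.mpr (h1 _)), hlog, hlog]
    ring

set_option maxHeartbeats 1000000 in
theorem exists_aux_parameters {d D L E C J N : ℕ} (hd : 3 ≤ d) (hD1 : 1 ≤ D) (hD : D ≤ d ^ 3)
    (hC : C = 40 * d + 68) (hL : L = 2 * (2 * d ^ 3 + 1) ^ 2 * C + 1) (hE : 64 * d * L ^ 3 < E)
    (hJ : J = E ^ (5 * d + 5)) {B s U A w : ℝ} (hB : (E : ℝ) ^ (10 * d + 16) ≤ B)
    (hB' : B ≤ (E : ℝ) ^ (20 * d + 32)) (hs : 1 / B ≤ s) (hs' : s ≤ J / B) (hN : N * s ≤ 1)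
    (hN' : 1 < (N + 1) * s) (hU : U = 2 * d * s * B) (hA : A = 2 * N / (E : ℝ) ^ 4)
    (hw : w ≤ 4 / (E : ℝ) ^ 4) :
    ∃ R S K T X : ℕ, R ≤ N ∧ L ≤ R ∧ 0 < S ∧ L * K < (R - L) * S ∧
      2 * (2 * D + 1) * T < K * L ∧ 32 * T ≤ X ∧ 4 * (X : ℝ) ^ (2 * D) ≤ (E : ℝ) ^ T ∧
      K * L * ((R + N * S) * E) ^ K * Real.exp (L * w * E * (R + N * S)) *
        Real.exp (L * (R * U + S * A)) ≤ X ∧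
      4 * (L * S) * (X : ℝ) ^ (2 * D) < Real.exp B := by
  have hL1 : 1 ≤ L := by omega
  have hL3 : L ≤ L ^ 3 := Nat.le_self_pow (by norm_num) _
  have hL2 : L ^ 2 ≤ L ^ 3 := Nat.pow_le_pow_right hL1 (by norm_num)
  have hELn : 192 * L < E := by
    refine lt_of_le_of_lt ?_ hE
    calc 192 * L = 64 * 3 * L := by ring
      _ ≤ 64 * d * L ^ 3 := by gcongr
  have hE1000 : 1000 ≤ E := by
    have : 68 ≤ L := by
      have h1 : 1 ≤ (2 * d ^ 3 + 1) ^ 2 := Nat.one_le_pow _ _ (by omega)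
      calc 68 ≤ 2 * 1 * C := by omega
        _ ≤ 2 * (2 * d ^ 3 + 1) ^ 2 * C := by gcongr
        _ ≤ L := by omega
    omega
  have hEdL2n : 8 * d * L ^ 2 ≤ E := by
    refine le_trans ?_ hE.le
    gcongr
    norm_num
  have hEL : (192 : ℝ) * L ≤ E := by exact_mod_cast hELn.le
  have hEdL2 : (8 : ℝ) * d * L ^ 2 ≤ E := by exact_mod_cast hEdL2n
  have hEdL3 : (64 : ℝ) * d * L ^ 3 < E := by exact_mod_cast hE
  have hEr : (1000 : ℝ) ≤ E := by exact_mod_cast hE1000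
  have hE0 : (0 : ℝ) < E := by linarith
  have hE1 : (1 : ℝ) ≤ E := by linarith
  have hLr : (1 : ℝ) ≤ L := by exact_mod_cast hL1
  have hdr : (3 : ℝ) ≤ d := by exact_mod_cast hd
  have hJr : (J : ℝ) = (E : ℝ) ^ (5 * d + 5) := by exact_mod_cast hJ
  have hJ0 : (0 : ℝ) < J := by rw [hJr]; positivity
  have hBJ : (J : ℝ) * (E : ℝ) ^ 9 ≤ B := by
    refine le_trans ?_ hB
    rw [hJr, ← pow_add]
    exact pow_le_pow_right₀ hE1 (by omega)
  have hBpos : 0 < B := lt_of_lt_of_le (by positivity) hB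
  have hBE : (E : ℝ) ^ 4 ≤ B := (pow_le_pow_right₀ hE1 (by omega)).trans hB
  have hs0 : 0 < s := lt_of_lt_of_le (by positivity) hs
  have hsB : 1 ≤ s * B := by rwa [div_le_iff₀ hBpos] at hs
  have hsB' : s * B ≤ J := by rwa [le_div_iff₀ hBpos] at hs'
  have hNB : (N : ℝ) ≤ B := by
    calc (N : ℝ) = N * 1 := (mul_one _).symm
      _ ≤ N * (s * B) := by gcongr
      _ = N * s * B := by ring
      _ ≤ 1 * B := by gcongr
      _ = B := one_mul B
  -- `N` is large
  have hNJ : B ≤ 2 * N * J := by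
    have h1 : B ≤ (N + 1) * J := by
      calc B = 1 * B := (one_mul B).symm
        _ ≤ (N + 1) * s * B := by gcongr
        _ = (N + 1) * (s * B) := by ring
        _ ≤ (N + 1) * J := by gcongr
    have h2 : (J : ℝ) * 2 ≤ B := by
      refine le_trans ?_ hBJ
      gcongr
      calc (2 : ℝ) ≤ E := by linarith
        _ ≤ E ^ 9 := le_self_pow₀ hE1 (by norm_num)
    linarith
  have hNE : (E : ℝ) ^ 9 ≤ 2 * N := by
    have : (J : ℝ) * E ^ 9 ≤ J * (2 * N) := by linarith
    exact le_of_mul_le_mul_left this hJ0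
  have hN1 : (1 : ℝ) ≤ N := by
    have : (1000 : ℝ) ≤ E ^ 9 := hEr.trans (le_self_pow₀ hE1 (by norm_num))
    linarith
  have hA1 : 1 ≤ A := by
    rw [hA, le_div_iff₀ (by positivity), one_mul]
    exact (pow_le_pow_right₀ hE1 (by norm_num)).trans hNE
  have hU1 : 1 ≤ U := by
    calc (1 : ℝ) = 1 * 1 := by ring
      _ ≤ 2 * d * (s * B) := by gcongr; linarith
      _ = U := by rw [hU]; ring
  have hUA : U * A * E ^ 4 ≤ 4 * d * B := by
    rw [hU, hA]
    have : 2 * d * s * B * (2 * N / (E : ℝ) ^ 4) * E ^ 4 = 4 * d * B * (N * s) := by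
      field_simp; ring
    rw [this]
    exact mul_le_of_le_one_right (by positivity) hN
  obtain ⟨K, hKd⟩ : ∃ K, K = ⌊B / (E : ℝ) ^ 2⌋₊ := ⟨_, rfl⟩
  have hKle : (K : ℝ) * E ^ 2 ≤ B := by
    rw [← le_div_iff₀ (by positivity), hKd]
    exact Nat.floor_le (by positivity)
  have hKge : B ≤ 2 * K * E ^ 2 := by
    have h1 : B / (E : ℝ) ^ 2 < K + 1 := by rw [hKd]; exact Nat.lt_floor_add_one _
    rw [div_lt_iff₀ (by positivity)] at h1
    have h2 : 2 * (E : ℝ) ^ 2 ≤ B := by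
      refine le_trans ?_ hBE
      calc 2 * (E : ℝ) ^ 2 ≤ E * E ^ 2 := by gcongr; linarith
        _ = (E : ℝ) ^ 3 := by ring
        _ ≤ (E : ℝ) ^ 4 := pow_le_pow_right₀ hE1 (by norm_num)
    linarith
  have hK1 : (1 : ℝ) ≤ K := by
    have h1 : (0 : ℝ) < K := by
      by_contra h
      have : (K : ℝ) = 0 := le_antisymm (not_lt.mp h) (by positivity)
      rw [this] at hKge
      linarith
    have : 0 < K := by exact_mod_cast h1
    exact_mod_cast this
  have hK1n : 1 ≤ K := by exact_mod_cast hK1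
  obtain ⟨R, hRd⟩ : ∃ R, R = ⌊K / (L * U)⌋₊ := ⟨_, rfl⟩
  obtain ⟨S, hSd⟩ : ∃ S, S = ⌊K / (L * E * A)⌋₊ := ⟨_, rfl⟩
  have hRle : (R : ℝ) * (L * U) ≤ K := by
    rw [← le_div_iff₀ (by positivity), hRd]
    exact Nat.floor_le (by positivity)
  have hSle : (S : ℝ) * (L * E * A) ≤ K := by
    rw [← le_div_iff₀ (by positivity), hSd]
    exact Nat.floor_le (by positivity)
  have hRgt : (K : ℝ) < (R + 1) * (L * U) := by
    rw [← div_lt_iff₀ (by positivity), hRd]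
    exact Nat.lt_floor_add_one _
  have hSgt : (K : ℝ) < (S + 1) * (L * E * A) := by
    rw [← div_lt_iff₀ (by positivity), hSd]
    exact Nat.lt_floor_add_one _
  have hR2L : 2 * L ≤ R := by
    rw [hRd]
    refine Nat.le_floor ?_
    rw [le_div_iff₀ (by positivity)]
    push_cast
    have h1 : U ≤ 2 * d * J := by
      rw [hU, mul_assoc]
      gcongr
    have h2 : 8 * d * (L : ℝ) ^ 2 * J * E ^ 2 ≤ B := by
      refine le_trans ?_ hBJ
      calc 8 * d * (L : ℝ) ^ 2 * J * E ^ 2 ≤ E * J * E ^ 2 := by gcongr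
        _ = J * (E : ℝ) ^ 3 := by ring
        _ ≤ J * (E : ℝ) ^ 9 := by gcongr; norm_num
    have h3 : 8 * d * (L : ℝ) ^ 2 * J ≤ 2 * K := by
      have : 8 * d * (L : ℝ) ^ 2 * J * E ^ 2 ≤ 2 * K * E ^ 2 := h2.trans hKge
      exact le_of_mul_le_mul_right this (by positivity)
    calc 2 * (L : ℝ) * (L * U) = 2 * L ^ 2 * U := by ring
      _ ≤ 2 * L ^ 2 * (2 * d * J) := by gcongr
      _ ≤ K := by linarith
  have hS1 : 1 ≤ S := by
    rw [hSd]
    refine Nat.le_floor ?_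
    rw [le_div_iff₀ (by positivity)]
    push_cast
    have h1 : L * E * A * (2 * E ^ 3) ≤ 4 * L * B := by
      rw [hA]
      have : L * E * (2 * N / (E : ℝ) ^ 4) * (2 * E ^ 3) = 4 * L * N := by field_simp; ring
      rw [this]
      gcongr
    have h2 : 4 * L * B ≤ K * (2 * E ^ 3) := by
      calc 4 * L * B ≤ 4 * L * (2 * K * E ^ 2) := by gcongr
        _ = (4 * L) * (K * (2 * E ^ 2)) := by ring
        _ ≤ E * (K * (2 * E ^ 2)) := by gcongr; linarith
        _ = _ := by ring
    have := le_of_mul_le_mul_right (h1.trans h2) (by positivity)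
    linarith
  have hKB : (K : ℝ) * 1000 ≤ B := by
    refine le_trans ?_ hKle
    gcongr
    exact hEr.trans (le_self_pow₀ hE1 (by norm_num))
  have hS1r : (1 : ℝ) ≤ S := by exact_mod_cast hS1
  have hR2Lr : (2 : ℝ) * L ≤ R := by exact_mod_cast hR2L
  have hSK : (S : ℝ) ≤ K := by
    refine le_trans (le_mul_of_one_le_right (by positivity) ?_) hSle
    exact one_le_mul_of_one_le_of_one_le (one_le_mul_of_one_le_of_one_le hLr hE1) hA1
  have hRN : R ≤ N := by
    have h1 : (R : ℝ) * (2 * s) ≤ (N + 1) * s := by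
      have h2 : (R : ℝ) * (1 * (2 * 1 * s * B)) ≤ R * (L * U) := by
        rw [hU]; gcongr; linarith
      have h3 : (R : ℝ) * (2 * s) * B ≤ 1 * B := by
        have h4 : (R : ℝ) * (2 * s) * B = R * (1 * (2 * 1 * s * B)) := by ring
        linarith
      exact (le_of_mul_le_mul_right h3 hBpos).trans hN'.le
    have h4 : (R : ℝ) * 2 ≤ N + 1 := by
      have : (R : ℝ) * 2 * s ≤ (N + 1) * s := by linarith
      exact le_of_mul_le_mul_right this hs0
    have h5 : R * 2 ≤ N + 1 := by exact_mod_cast h4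
    omega
  have hcard : L * K < (R - L) * S := by
    have h1 : (L : ℝ) * K < (R - L) * S := by
      have hRge : (K : ℝ) ≤ 4 * (R - L) * (L * U) := by
        refine hRgt.le.trans ?_
        gcongr
        linarith
      have hSge : (K : ℝ) ≤ 2 * S * (L * E * A) := by
        refine hSgt.le.trans ?_
        gcongr
        linarith
      have hRL0 : 0 ≤ (R : ℝ) - L := by linarith
      have h2 : (K : ℝ) * K ≤ (4 * (R - L) * (L * U)) * (2 * S * (L * E * A)) :=
        mul_le_mul hRge hSge (by positivity) (by positivity)
      have h3 : (K : ℝ) * K * E ^ 3 ≤ ((R - L) * S) * (32 * L ^ 2 * d) * B := by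
        calc (K : ℝ) * K * E ^ 3 ≤ (4 * (R - L) * (L * U)) * (2 * S * (L * E * A)) * E ^ 3 := by
              gcongr
          _ = ((R - L) * S) * (8 * L ^ 2) * (U * A * E ^ 4) := by ring
          _ ≤ ((R - L) * S) * (8 * L ^ 2) * (4 * d * B) := by gcongr
          _ = _ := by ring
      have h4 : (K : ℝ) * K * E ^ 3 ≤ ((R - L) * S) * (64 * L ^ 2 * d) * (K * E ^ 2) := by
        calc _ ≤ _ := h3
          _ ≤ ((R - L) * S) * (32 * L ^ 2 * d) * (2 * K * E ^ 2) := by gcongr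
          _ = _ := by ring
      have h5 : (K : ℝ) * E ≤ ((R - L) * S) * (64 * L ^ 2 * d) := by
        have : (K : ℝ) * E * (K * E ^ 2) ≤ ((R - L) * S) * (64 * L ^ 2 * d) * (K * E ^ 2) := by
          linarith
        exact le_of_mul_le_mul_right this (by positivity)
      have h6 : (K : ℝ) * (64 * d * L ^ 3) < K * E := by gcongr
      have h7 : (L : ℝ) * K * (64 * L ^ 2 * d) < ((R - L) * S) * (64 * L ^ 2 * d) := by
        calc _ = (K : ℝ) * (64 * d * L ^ 3) := by ring
          _ < _ := h6
          _ ≤ _ := h5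
      exact lt_of_mul_lt_mul_right h7 (by positivity)
    have h2 : ((R - L : ℕ) : ℝ) = R - L := Nat.cast_sub (by omega)
    rw [← h2] at h1
    exact_mod_cast h1
  have hCK1 : 1 ≤ C * K := Nat.mul_pos (by omega) hK1n
  have hDC : 2 * (2 * D + 1) * ((2 * D + 1) * C) < L := by
    rw [hL]
    have : (2 * D + 1) * (2 * D + 1) ≤ (2 * d ^ 3 + 1) ^ 2 := by
      rw [sq]; gcongr
    have := Nat.mul_le_mul_right (2 * C) this
    linarith
  refine ⟨R, S, K, (2 * D + 1) * C * K, E ^ (C * K), hRN, by omega, hS1, hcard, ?_, ?_, ?_, ?_, ?_⟩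
  · calc _ = 2 * (2 * D + 1) * ((2 * D + 1) * C) * K := by ring
      _ < L * K := by gcongr
      _ = _ := mul_comm _ _
  · have h1 : (2 * D + 1) * C ≤ L := (Nat.le_mul_of_pos_left _ (by omega)).trans hDC.le
    calc 32 * ((2 * D + 1) * C * K) ≤ 32 * (L * K) := by gcongr
      _ = (32 * L) * K := by ring
      _ ≤ E * E ^ K := by
        gcongr
        · omega
        · exact (Nat.lt_pow_self (by omega)).le
      _ = E ^ (K + 1) := by ring
      _ ≤ E ^ (C * K) := Nat.pow_le_pow_right (by omega) (by
        calc K + 1 ≤ 2 * K := by omega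
          _ ≤ C * K := by gcongr; omega)
  · push_cast
    rw [← pow_mul]
    have : (2 * D + 1) * C * K = C * K * (2 * D) + C * K := by ring
    rw [this, pow_add, mul_comm]
    gcongr
    calc (4 : ℝ) ≤ E := by linarith
      _ ≤ E ^ (C * K) := le_self_pow₀ hE1 (by omega)
  · have hz : (R : ℝ) + N * S ≤ 2 * N * S := by
      have h1 : (R : ℝ) ≤ N := by exact_mod_cast hRN
      have h2 : (N : ℝ) ≤ N * S := le_mul_of_one_le_right (by positivity) hS1r
      linarith
    have hz2 : (R : ℝ) + N * S ≤ B ^ 2 := by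
      refine hz.trans ?_
      have h1 : 2 * (S : ℝ) ≤ B := by linarith
      calc 2 * (N : ℝ) * S = N * (2 * S) := by ring
        _ ≤ B * B := by gcongr
        _ = _ := by ring
    have h1 : L * w * E * (R + N * S) ≤ 4 * K := by
      calc L * w * E * (R + N * S) ≤ L * (4 / (E : ℝ) ^ 4) * E * (2 * N * S) := by gcongr
        _ = 4 * (S * (L * E * (2 * N / E ^ 4))) := by ring
        _ = 4 * (S * (L * E * A)) := by rw [hA]
        _ ≤ _ := by gcongr
    have h2 : L * (R * U + S * A) ≤ 2 * K := by
      have h3 : (S : ℝ) * (L * 1 * A) ≤ S * (L * E * A) := by gcongr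
      have h4 : L * (R * U + S * A) = R * (L * U) + S * (L * 1 * A) := by ring
      rw [h4]
      linarith
    have h3 : Real.exp (L * w * E * (R + N * S)) * Real.exp (L * (R * U + S * A)) ≤
        (E : ℝ) ^ K := by
      rw [← Real.exp_add]
      calc Real.exp _ ≤ Real.exp (K * 6) := by
            rw [Real.exp_le_exp]; linarith
        _ = (Real.exp 6) ^ K := by rw [Real.exp_nat_mul]
        _ ≤ (E : ℝ) ^ K := by
          gcongr
          have h4 : Real.exp 6 = Real.exp 1 ^ 6 := by rw [← Real.exp_nat_mul]; norm_num
          have h5 : Real.exp 1 ^ 6 ≤ 3 ^ 6 := by gcongr; exact Real.exp_one_lt_three.le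
          rw [h4]
          linarith
    have h4 : (K : ℝ) ≤ E ^ K := by
      exact_mod_cast (Nat.lt_pow_self (by omega : 1 < E)).le
    have h5 : (L : ℝ) ≤ E ^ K := by
      refine le_trans ?_ (le_self_pow₀ hE1 (by omega))
      linarith
    have h6 : (B ^ 2 * E) ^ K ≤ ((E : ℝ) ^ (40 * d + 65)) ^ K := by
      gcongr
      calc B ^ 2 * E ≤ ((E : ℝ) ^ (20 * d + 32)) ^ 2 * E := by gcongr
        _ = _ := by rw [← pow_mul, ← pow_succ]; congr 1; ring
    calc K * L * ((R + N * S) * E) ^ K * Real.exp (L * w * E * (R + N * S)) *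
        Real.exp (L * (R * U + S * A)) = K * L * ((R + N * S) * E) ^ K *
          (Real.exp (L * w * E * (R + N * S)) * Real.exp (L * (R * U + S * A))) := by ring
      _ ≤ (E ^ K) * (E ^ K) * (B ^ 2 * E) ^ K * E ^ K := by gcongr
      _ ≤ (E ^ K) * (E ^ K) * ((E : ℝ) ^ (40 * d + 65)) ^ K * E ^ K := by gcongr
      _ = ((E ^ (C * K) : ℕ) : ℝ) := by
        push_cast
        rw [← pow_mul, ← pow_add, ← pow_add, ← pow_add, hC]
        congr 1
        ring
  · push_cast
    rw [← pow_mul]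
    have hEexp : (E : ℝ) ≤ Real.exp E := by linarith [Real.add_one_le_exp (E : ℝ)]
    have hDCL : 8 * (D : ℝ) * C ≤ E := by
      have : 2 * (2 * D + 1) * ((2 * D + 1) * C) = 8 * D * C + (8 * D ^ 2 + 2) * C := by ring
      have : 8 * D * C ≤ E := by omega
      exact_mod_cast this
    have h1 : (E : ℝ) ^ (C * K * (2 * D)) ≤ Real.exp (B / 4) := by
      calc (E : ℝ) ^ (C * K * (2 * D)) ≤ Real.exp E ^ (C * K * (2 * D)) := by gcongr
        _ = Real.exp (((C * K * (2 * D) : ℕ) : ℝ) * E) := by rw [← Real.exp_nat_mul]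
        _ ≤ _ := by
          rw [Real.exp_le_exp]
          push_cast
          calc (C : ℝ) * K * (2 * D) * E = (8 * D * C) * (K * E) / 4 := by ring
            _ ≤ E * (K * E) / 4 := by gcongr
            _ = K * E ^ 2 / 4 := by ring
            _ ≤ _ := by gcongr
    have h2 : B ≤ 4 * Real.exp (B / 4) := by linarith [Real.add_one_le_exp (B / 4)]
    have h3 : 16 * (L : ℝ) ≤ Real.exp (B / 4) := by
      have h4 : (E : ℝ) ≤ B / 4 := by
        have : (E : ℝ) * E ^ 3 ≤ B := by
          calc (E : ℝ) * E ^ 3 = E ^ 4 := by ring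
            _ ≤ B := hBE
        have h5 : (1000 : ℝ) ≤ E ^ 3 := hEr.trans (le_self_pow₀ hE1 (by norm_num))
        have h6 : (E : ℝ) * 1000 ≤ E * E ^ 3 := by gcongr
        linarith
      linarith [Real.add_one_le_exp (B / 4)]
    calc 4 * (L * S : ℝ) * E ^ (C * K * (2 * D))
        ≤ 4 * (L * (4 * Real.exp (B / 4))) * Real.exp (B / 4) := by
          gcongr
          linarith
      _ = (16 * L) * Real.exp (B / 4) * Real.exp (B / 4) := by ring
      _ ≤ Real.exp (B / 4) * Real.exp (B / 4) * Real.exp (B / 4) := by gcongr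
      _ = Real.exp (3 * B / 4) := by
          rw [← Real.exp_add, ← Real.exp_add]; congr 1; ring
      _ < _ := by
          rw [Real.exp_lt_exp]; linarith

theorem exists_compositum_embeddings {K : Type*} [Field K] [NumberField K] (σ₁ σ₂ σ₃ : K →+* ℂ) :
    ∃ (F : Type) (_ : Field F) (_ : NumberField F) (φ : F →+* ℂ) (ψ₁ ψ₂ ψ₃ : K →+* F),
      φ.comp ψ₁ = σ₁ ∧ φ.comp ψ₂ = σ₂ ∧ φ.comp ψ₃ = σ₃ ∧
      Module.finrank ℚ F ≤ Module.finrank ℚ K ^ 3 := by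
  let E : (K →+* ℂ) → IntermediateField ℚ ℂ := fun σ => σ.toRatAlgHom.fieldRange
  have hfr : ∀ σ, Module.finrank ℚ (E σ) = Module.finrank ℚ K := fun σ =>
    (LinearEquiv.finrank_eq (AlgEquiv.ofInjectiveField σ.toRatAlgHom).toLinearEquiv).symm
  have hfd : ∀ σ, FiniteDimensional ℚ (E σ) := fun σ =>
    Module.Finite.equiv (AlgEquiv.ofInjectiveField σ.toRatAlgHom).toLinearEquiv
  have h1 := hfd σ₁
  have h2 := hfd σ₂
  have h3 := hfd σ₃
  have h12 : FiniteDimensional ℚ ↥(E σ₁ ⊔ E σ₂) := IntermediateField.finiteDimensional_sup _ _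
  have h123 : FiniteDimensional ℚ ↥(E σ₁ ⊔ E σ₂ ⊔ E σ₃) :=
    IntermediateField.finiteDimensional_sup _ _
  have hmem : ∀ (σ : K →+* ℂ) (x : K), σ x ∈ E σ := fun σ x => ⟨x, rfl⟩
  refine ⟨↥(E σ₁ ⊔ E σ₂ ⊔ E σ₃), inferInstance, ⟨⟩, algebraMap _ ℂ,
    σ₁.codRestrict _ fun x => ?_, σ₂.codRestrict _ fun x => ?_,
    σ₃.codRestrict _ fun x => ?_, rfl, rfl, rfl, ?_⟩
  · exact (le_sup_left.trans le_sup_left : E σ₁ ≤ _) (hmem σ₁ x)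
  · exact (le_sup_right.trans le_sup_left : E σ₂ ≤ _) (hmem σ₂ x)
  · exact (le_sup_right : E σ₃ ≤ _) (hmem σ₃ x)
  · calc _ ≤ Module.finrank ℚ ↥(E σ₁ ⊔ E σ₂) * Module.finrank ℚ (E σ₃) :=
        IntermediateField.finrank_sup_le _ _
      _ ≤ Module.finrank ℚ (E σ₁) * Module.finrank ℚ (E σ₂) * Module.finrank ℚ (E σ₃) := by
        gcongr
        exact IntermediateField.finrank_sup_le _ _
      _ = _ := by rw [hfr, hfr, hfr]; ring

theorem one_le_norm_sub_mul_pow {K : Type*} [Field K] [NumberField K] (θ : 𝓞 K) {Y : ℝ}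
    (hY1 : 1 ≤ Y) (hY : ∀ σ : K →+* ℂ, ‖σ θ‖ ≤ Y) {σ τ : K →+* ℂ} (hne : σ θ ≠ τ θ) :
    1 ≤ ‖σ θ - τ θ‖ * (2 * Y) ^ (Module.finrank ℚ K ^ 3) := by
  obtain ⟨F, _, _, φ, ψ₁, ψ₂, -, rfl, rfl, -, hF⟩ := exists_compositum_embeddings σ τ σ
  have h := one_le_norm_mul_pow φ
    (RingOfIntegers.mapRingHom ψ₁ θ - RingOfIntegers.mapRingHom ψ₂ θ) (Y := 2 * Y) ?_ ?_
  · have h2 : φ ((RingOfIntegers.mapRingHom ψ₁ θ - RingOfIntegers.mapRingHom ψ₂ θ : 𝓞 F) : F) =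
        φ.comp ψ₁ θ - φ.comp ψ₂ θ := by
      simp
    rw [h2] at h
    refine h.trans ?_
    gcongr
    · linarith
    · omega
  · intro h0
    apply hne
    have h1 := congrArg (fun z : 𝓞 F => φ (z : F)) (sub_eq_zero.mp h0)
    simpa using h1
  · intro τ
    have h1 := hY (τ.comp ψ₁)
    have h2 := hY (τ.comp ψ₂)
    simp only [RingHom.comp_apply] at h1 h2
    simp only [map_sub, RingOfIntegers.mapRingHom_apply]
    exact (norm_sub_le _ _).trans (by linarith)

theorem exists_small_conjugate {K : Type*} [Field K] [NumberField K] {d : ℕ} (hd : 3 ≤ d)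
    (hdK : Module.finrank ℚ K = d) (θ : 𝓞 K) {Y : ℝ}
    (hY1 : 1 ≤ Y) (hinj : ∀ σ τ : K →+* ℂ, σ θ = τ θ → σ = τ) (hY : ∀ σ : K →+* ℂ, ‖σ θ‖ ≤ Y)
    {a x y : ℤ} (ha : a ≠ 0) (haY : |(a : ℝ)| ≤ Y) {β : 𝓞 K} (hβ : β = a * x - θ * y)
    (hβ0 : β ≠ 0) {B h : ℝ} (hX : Real.exp B = max |(x : ℝ)| |(y : ℝ)|)
    (hh : h = (d ^ 3 + 1 : ℕ) * Real.log (2 * Y)) (hBh : d * h ≤ B) :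
    ∃ σ₁ : K →+* ℂ, (∀ σ, σ ≠ σ₁ → |Real.log ‖σ β‖ - B| ≤ h) ∧
      (∀ σ : K →+* ℂ, |Real.log ‖σ β‖| ≤ d * B) ∧
      Real.log ‖σ₁ β‖ ≤ Real.log |(Algebra.norm ℤ β : ℝ)| + 2 * h - 2 * B := by
  classical
  have hdr : (3 : ℝ) ≤ d := by exact_mod_cast hd
  have hlogY : 0 ≤ Real.log (2 * Y) := Real.log_nonneg (by linarith)
  have hh0 : 0 ≤ h := by rw [hh]; positivity
  have hlogYh : Real.log (2 * Y) ≤ h := by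
    rw [hh]
    refine le_mul_of_one_le_left hlogY ?_
    exact_mod_cast Nat.le_add_left 1 (d ^ 3)
  have hexph : Real.exp h = (2 * Y) ^ (d ^ 3 + 1) := by
    rw [hh, Real.exp_nat_mul, Real.exp_log (by linarith)]
  have hpos : ∀ σ : K →+* ℂ, 0 < ‖σ β‖ := fun σ => by
    rw [norm_pos_iff, map_ne_zero]
    exact_mod_cast hβ0
  have hβσ : ∀ σ : K →+* ℂ, σ β = a * x - σ θ * y := fun σ => by
    rw [hβ]; simp
  have hupper : ∀ σ : K →+* ℂ, Real.log ‖σ β‖ ≤ B + h := fun σ => by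
    rw [Real.log_le_iff_le_exp (hpos σ), Real.exp_add, hX, hexph, hβσ]
    calc ‖(a : ℂ) * x - σ θ * y‖ ≤ ‖(a : ℂ) * x‖ + ‖σ θ * y‖ := norm_sub_le _ _
      _ = |(a : ℝ)| * |(x : ℝ)| + ‖σ θ‖ * |(y : ℝ)| := by simp
      _ ≤ Y * max |(x : ℝ)| |(y : ℝ)| + Y * max |(x : ℝ)| |(y : ℝ)| := by
        gcongr
        · exact le_max_left _ _
        · exact hY σ
        · exact le_max_right _ _
      _ = max |(x : ℝ)| |(y : ℝ)| * (2 * Y) := by ring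
      _ ≤ _ := by
        gcongr
        exact le_self_pow₀ (by linarith) (by omega)
  obtain ⟨σ₁, -, hmin⟩ := Finset.exists_min_image (Finset.univ : Finset (K →+* ℂ))
    (fun σ => ‖σ β‖) Finset.univ_nonempty
  have hlower : ∀ σ : K →+* ℂ, σ ≠ σ₁ → B - h ≤ Real.log ‖σ β‖ := fun σ hσ => by
    have hne : σ₁ θ ≠ σ θ := fun he => hσ (hinj _ _ he).symm
    have hsep := one_le_norm_sub_mul_pow θ hY1 hY hne
    rw [hdK] at hsep
    have hm := hmin σ (Finset.mem_univ _)
    have hy : ‖σ₁ θ - σ θ‖ * |(y : ℝ)| ≤ 2 * Y * ‖σ β‖ := by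
      calc ‖σ₁ θ - σ θ‖ * |(y : ℝ)| = ‖σ β - σ₁ β‖ := by
            rw [hβσ, hβσ, ← Complex.norm_intCast, ← norm_mul]; congr 1; ring
        _ ≤ ‖σ β‖ + ‖σ₁ β‖ := norm_sub_le _ _
        _ ≤ 2 * 1 * ‖σ β‖ := by linarith
        _ ≤ _ := by gcongr
    have hx : ‖σ₁ θ - σ θ‖ * |(x : ℝ)| ≤ 2 * Y * ‖σ β‖ := by
      have ha1 : 1 ≤ |(a : ℝ)| := by exact_mod_cast Int.one_le_abs ha
      calc ‖σ₁ θ - σ θ‖ * |(x : ℝ)| = ‖σ₁ θ - σ θ‖ * (1 * |(x : ℝ)|) := by rw [one_mul]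
        _ ≤ ‖σ₁ θ - σ θ‖ * (|(a : ℝ)| * |(x : ℝ)|) := by gcongr
        _ = ‖σ₁ θ * σ β - σ θ * σ₁ β‖ := by
            rw [hβσ, hβσ, ← Complex.norm_intCast, ← Complex.norm_intCast, ← norm_mul, ← norm_mul]
            congr 1; ring
        _ ≤ ‖σ₁ θ * σ β‖ + ‖σ θ * σ₁ β‖ := norm_sub_le _ _
        _ ≤ Y * ‖σ β‖ + Y * ‖σ β‖ := by
            rw [norm_mul, norm_mul]
            gcongr
            · exact hY _
            · exact hY _
        _ = _ := by ring
    have hxy : ‖σ₁ θ - σ θ‖ * Real.exp B ≤ 2 * Y * ‖σ β‖ := by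
      rw [hX]
      rcases max_choice |(x : ℝ)| |(y : ℝ)| with h | h <;> rw [h] <;> assumption
    rw [Real.le_log_iff_exp_le (hpos σ), Real.exp_sub, div_le_iff₀ (Real.exp_pos _), hexph]
    calc Real.exp B = 1 * Real.exp B := (one_mul _).symm
      _ ≤ ‖σ₁ θ - σ θ‖ * (2 * Y) ^ d ^ 3 * Real.exp B := by gcongr
      _ = (2 * Y) ^ d ^ 3 * (‖σ₁ θ - σ θ‖ * Real.exp B) := by ring
      _ ≤ (2 * Y) ^ d ^ 3 * (2 * Y * ‖σ β‖) := by gcongr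
      _ = _ := by ring
  have hBh' : 3 * h ≤ B := by nlinarith
  have hsum : Real.log |(Algebra.norm ℤ β : ℝ)| =
      Real.log ‖σ₁ β‖ + ∑ σ ∈ Finset.univ.erase σ₁, Real.log ‖σ β‖ := by
    rw [Finset.add_sum_erase _ (fun σ : K →+* ℂ => Real.log ‖σ β‖) (Finset.mem_univ σ₁),
      ← Real.log_prod (fun σ _ => (hpos σ).ne'), prod_norm_embeddings_eq, Nat.cast_natAbs]
    simp
  have hcard : ((Finset.univ.erase σ₁ : Finset (K →+* ℂ)).card : ℝ) = d - 1 := by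
    rw [Finset.card_erase_of_mem (Finset.mem_univ _), Finset.card_univ, Embeddings.card, hdK,
      Nat.cast_sub (by omega), Nat.cast_one]
  have hsumle : ∑ σ ∈ Finset.univ.erase σ₁, Real.log ‖σ β‖ ≤ (d - 1) * (B + h) := by
    rw [← hcard, ← nsmul_eq_mul]
    exact Finset.sum_le_card_nsmul _ _ _ fun σ _ => hupper σ
  have hlesum : (d - 1) * (B - h) ≤ ∑ σ ∈ Finset.univ.erase σ₁, Real.log ‖σ β‖ := by
    rw [← hcard, ← nsmul_eq_mul]
    exact Finset.card_nsmul_le_sum _ _ _ fun σ hσ => hlower σ (Finset.ne_of_mem_erase hσ)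
  have hN : 0 ≤ Real.log |(Algebra.norm ℤ β : ℝ)| := by
    apply Real.log_nonneg
    exact_mod_cast Int.one_le_abs (by simpa using hβ0)
  refine ⟨σ₁, fun σ hσ => ?_, fun σ => ?_, ?_⟩
  · rw [abs_le]
    exact ⟨by linarith [hlower σ hσ], by linarith [hupper σ]⟩
  · have hdB : 3 * B ≤ d * B := by gcongr; linarith
    rw [abs_le]
    refine ⟨?_, by linarith [hupper σ]⟩
    rcases eq_or_ne σ σ₁ with rfl | hσ
    · linarith
    · linarith [hlower σ hσ]
  · have : 2 * (B - h) ≤ (d - 1) * (B - h) := by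
      gcongr
      · linarith
      · linarith
    linarith

theorem aux_size_bounds {d E J N : ℕ} (hd : 3 ≤ d) (hE : 2 ^ (d ^ 3 + 3) ≤ E)
    (hJ : J = E ^ (5 * d + 5)) {B s h : ℝ} (hB : (E : ℝ) ^ (10 * d + 16) ≤ B)
    (hs : 1 / B ≤ s) (hs' : s ≤ J / B) (hN : N * s ≤ 1) (hN' : 1 < (N + 1) * s)
    (hh : h ≤ E) :
    d * B * s + N * (1 / (E : ℝ) ^ 4) + h ≤ 2 * N / (E : ℝ) ^ 4 ∧
    2 * (1 / (E : ℝ) ^ 4) + s * (2 * h) ≤ 3 * (1 / (E : ℝ) ^ 4) ∧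
    d * B * s + 1 / (E : ℝ) ^ 4 ≤ 2 * d * s * B ∧
    (d ^ 3 + 1) * (2 * N / (E : ℝ) ^ 4 + 1) < B := by
  have hpow : d ^ 3 + 3 < 2 ^ (d ^ 3 + 3) := Nat.lt_two_pow_self
  have hdd : d < 2 ^ d := Nat.lt_two_pow_self
  have hd3 : d ≤ d ^ 3 := Nat.le_self_pow (by norm_num) _
  have h4d : 8 * d ≤ E := by
    calc 8 * d ≤ 8 * 2 ^ d := by gcongr
      _ = 2 ^ (d + 3) := by ring
      _ ≤ 2 ^ (d ^ 3 + 3) := by gcongr; norm_num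
      _ ≤ E := hE
  have hE1 : (1 : ℝ) ≤ E := by exact_mod_cast (by omega : 1 ≤ E)
  have hE24 : (24 : ℝ) ≤ E := by exact_mod_cast (by omega : 24 ≤ E)
  have hE0 : (0 : ℝ) < E := by linarith
  have hd3E : ((d : ℝ) ^ 3 + 1) ≤ E := by exact_mod_cast (by omega : d ^ 3 + 1 ≤ E)
  have h4dr : (8 * d : ℝ) ≤ E := by exact_mod_cast h4d
  have hdr : (3 : ℝ) ≤ d := by exact_mod_cast hd
  have hJr : (J : ℝ) = (E : ℝ) ^ (5 * d + 5) := by exact_mod_cast hJ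
  have hJ0 : (0 : ℝ) < J := by rw [hJr]; positivity
  have hBJ : (J : ℝ) * (E : ℝ) ^ 11 ≤ B := by
    refine le_trans ?_ hB
    rw [hJr, ← pow_add]
    exact pow_le_pow_right₀ hE1 (by omega)
  have hBJJ : (J : ℝ) * (J * (E : ℝ) ^ 6) ≤ B := by
    refine le_trans ?_ hB
    rw [hJr, ← pow_add, ← pow_add]
    exact pow_le_pow_right₀ hE1 (by omega)
  have hEJ : (E : ℝ) ≤ J := by
    rw [hJr]; exact le_self_pow₀ hE1 (by omega)
  have hBpos : 0 < B := lt_of_lt_of_le (by positivity) hB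
  have hs0 : 0 < s := lt_of_lt_of_le (by positivity) hs
  have hsB : 1 ≤ s * B := by rwa [div_le_iff₀ hBpos] at hs
  have hsB' : s * B ≤ J := by rwa [le_div_iff₀ hBpos] at hs'
  have hNB : (N : ℝ) ≤ B := by
    have h1 : (N : ℝ) * 1 ≤ N * (s * B) := by gcongr
    have h2 : N * s * B ≤ 1 * B := by gcongr
    linarith
  have hNJ : B ≤ 2 * N * J := by
    have h1 : B ≤ (N + 1) * J := by
      calc B = 1 * B := (one_mul B).symm
        _ ≤ (N + 1) * s * B := by gcongr
        _ = (N + 1) * (s * B) := by ring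
        _ ≤ _ := by gcongr
    have h2 : (J : ℝ) * 2 ≤ B := by
      refine le_trans ?_ hBJ
      gcongr
      calc (2 : ℝ) ≤ E := by linarith
        _ ≤ E ^ 11 := le_self_pow₀ hE1 (by norm_num)
    linarith
  have hNJE : (J : ℝ) * (E : ℝ) ^ 6 ≤ 2 * N := by
    have : (J : ℝ) * (J * E ^ 6) ≤ J * (2 * N) := by linarith
    exact le_of_mul_le_mul_left this hJ0
  have hE4 : (0 : ℝ) < (E : ℝ) ^ 4 := by positivity
  refine ⟨?_, ?_, ?_, ?_⟩
  · have h1 : d * B * s + h ≤ (d + 1) * J := by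
      have : d * (s * B) ≤ d * J := by gcongr
      linarith
    have h2 : (d + 1) * J * (E : ℝ) ^ 4 ≤ N := by
      have h3 : (2 * (d + 1) : ℝ) ≤ E ^ 2 :=
        (by linarith : (2 * (d + 1) : ℝ) ≤ E).trans (le_self_pow₀ hE1 (by norm_num))
      have h4 : (2 * (d + 1) : ℝ) * (J * E ^ 4) ≤ E ^ 2 * (J * E ^ 4) := by gcongr
      linarith
    have h3 : (d + 1) * (J : ℝ) ≤ N * (1 / (E : ℝ) ^ 4) := by
      rw [mul_one_div, le_div_iff₀ hE4]; exact h2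
    have h4 : 2 * N / (E : ℝ) ^ 4 = N * (1 / (E : ℝ) ^ 4) + N * (1 / (E : ℝ) ^ 4) := by ring
    linarith
  · have h1 : s * (2 * h) ≤ 1 / (E : ℝ) ^ 4 := by
      rw [le_div_iff₀ hE4]
      have h2 : s * B * (2 * h * E ^ 4) ≤ B := by
        calc s * B * (2 * h * (E : ℝ) ^ 4) ≤ s * B * ((E : ℝ) * E * (E : ℝ) ^ 4) := by
              have h2 : 2 * h ≤ E * E := by
                calc 2 * h ≤ 2 * E := by linarith
                  _ ≤ E * E := by gcongr; linarith
              gcongr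
          _ ≤ J * ((E : ℝ) * E * (E : ℝ) ^ 4) := by gcongr
          _ = J * (E : ℝ) ^ 6 := by ring
          _ ≤ J * (E : ℝ) ^ 11 := by gcongr; norm_num
          _ ≤ B := hBJ
      have h3 : s * (2 * h) * E ^ 4 * B ≤ 1 * B := by linarith
      exact le_of_mul_le_mul_right h3 hBpos
    linarith
  · have h1 : 1 / (E : ℝ) ^ 4 ≤ 1 := by
      rw [div_le_one hE4]; exact one_le_pow₀ hE1
    have h2 : 1 * 1 ≤ d * (s * B) := by gcongr; linarith
    linarith
  · calc (d ^ 3 + 1) * (2 * N / (E : ℝ) ^ 4 + 1) ≤ E * (2 * B / (E : ℝ) ^ 4 + 1) := by gcongr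
      _ = 2 * B / (E : ℝ) ^ 3 + E := by field_simp
      _ ≤ B / 3 + B / 3 := by
        have h1 : (24 : ℝ) ≤ E ^ 3 := hE24.trans (le_self_pow₀ hE1 (by norm_num))
        have hE3 : (0 : ℝ) < (E : ℝ) ^ 3 := by positivity
        have h2 : 24 * (E : ℝ) ≤ E ^ 11 := by
          calc 24 * (E : ℝ) ≤ E * E := by gcongr
            _ = E ^ 2 := by ring
            _ ≤ _ := pow_le_pow_right₀ hE1 (by norm_num)
        have h3 : 1 * (E : ℝ) ^ 11 ≤ J * (E : ℝ) ^ 11 := by gcongr; linarith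
        refine add_le_add ?_ (by linarith)
        rw [div_le_iff₀ hE3]
        have : B * 24 ≤ B * (E : ℝ) ^ 3 := by gcongr
        linarith
      _ < B := by linarith

theorem linear_form_not_small {F : Type*} [Field F] [NumberField F] (φ : F →+* ℂ)
    {d L C E J N : ℕ} (hd : 3 ≤ d) (hD : Module.finrank ℚ F ≤ d ^ 3)
    (hE2 : 2 ^ (d ^ 3 + 3) ≤ E) (hC : C = 40 * d + 68)
    (hL : L = 2 * (2 * d ^ 3 + 1) ^ 2 * C + 1) (hE : 64 * d * L ^ 3 < E)
    (hJ : J = E ^ (5 * d + 5)) {B s U A : ℝ} (hB : (E : ℝ) ^ (10 * d + 16) ≤ B)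
    (hB' : B ≤ (E : ℝ) ^ (20 * d + 32)) (hs : 1 / B ≤ s) (hs' : s ≤ J / B) (hN : N * s ≤ 1)
    (hN' : 1 < (N + 1) * s) (hU : U = 2 * d * s * B) (hA : A = 2 * N / (E : ℝ) ^ 4)
    {u w ζ p q : 𝓞 F} (hw : w ≠ 0) (hp : p ≠ 0) (hq : q ≠ 0) (huw : u = w * ζ)
    (huU : ∀ τ : F →+* ℂ, ‖τ u‖ ≤ Real.exp U) (hwU : ∀ τ : F →+* ℂ, ‖τ w‖ ≤ Real.exp U)
    (hpA : ∀ τ : F →+* ℂ, ‖τ p‖ ≤ Real.exp A) (hqA : ∀ τ : F →+* ℂ, ‖τ q‖ ≤ Real.exp A)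
    {ω : ℂ} (hζ : φ ζ = Complex.exp ω) (hω : ‖ω‖ ≤ 4 / (E : ℝ) ^ 4)
    (hδ0 : φ q / φ p * Complex.exp (-(N * ω)) - 1 ≠ 0)
    (hδ : ‖φ q / φ p * Complex.exp (-(N * ω)) - 1‖ ≤ Real.exp (-B)) : False := by
  have hD1 : 1 ≤ Module.finrank ℚ F := Module.finrank_pos
  have hpow : d ^ 3 + 3 < 2 ^ (d ^ 3 + 3) := Nat.lt_two_pow_self
  have hE1 : (1 : ℝ) ≤ E := by exact_mod_cast (by omega : 1 ≤ E)
  have hE0 : (0 : ℝ) < E := by linarith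
  have hdr : (3 : ℝ) ≤ d := by exact_mod_cast hd
  have hBpos : 0 < B := lt_of_lt_of_le (by positivity) hB
  have hs0 : 0 < s := lt_of_lt_of_le (by positivity) hs
  have hU0 : 0 ≤ U := by rw [hU]; positivity
  have hA0 : 0 ≤ A := by rw [hA]; positivity
  by_cases hη : ∀ n : ℕ, 0 < n → Complex.exp ω ^ n ≠ 1
  · obtain ⟨R, S, K, T, X, hRN, hLR, hS, hcard, hT, hTX, hET, hX, hfin⟩ :=
      exists_aux_parameters hd hD1 hD hC hL hE hJ hB hB' hs hs' hN hN' hU hA hω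
    have hωφ : φ u = φ w * Complex.exp ω := by
      rw [huw, ← hζ]; simp
    have := one_le_mul_norm_two_logs φ hw hp hq hU0 hA0 huU hwU hpA hqA hωφ hη hRN hLR hS hcard
      hE1 hT hTX hET hX
    have h2 : 4 * (L * S) * (X : ℝ) ^ (2 * Module.finrank ℚ F) *
        ‖φ q / φ p * Complex.exp (-(N * ω)) - 1‖ < Real.exp B * Real.exp (-B) :=
      mul_lt_mul hfin hδ (norm_pos_iff.mpr hδ0) (Real.exp_pos _).le
    rw [← Real.exp_add, add_neg_cancel, Real.exp_zero] at h2
    linarith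
  · push Not at hη
    obtain ⟨n, hn, hroot⟩ := hη
    have hζn : ζ ^ n = 1 := by
      apply RingOfIntegers.ext
      apply φ.injective
      rw [← hζ] at hroot
      simpa using hroot
    have hnorm : ∀ τ : F →+* ℂ, ‖τ ζ‖ = 1 := fun τ => by
      refine Complex.norm_eq_one_of_pow_eq_one (n := n) ?_ hn.ne'
      have := congrArg (fun z : 𝓞 F => τ (z : F)) hζn
      simpa using this
    have hexp : Complex.exp ω = 1 := by
      by_contra hne
      have h1 := one_le_norm_mul_pow φ (ζ - 1) (Y := 2) ?_ ?_
      · have h2 : φ ((ζ - 1 : 𝓞 F) : F) = Complex.exp ω - 1 := by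
          rw [← hζ]; simp
        rw [h2] at h1
        have h16 : (2 : ℝ) ^ (d ^ 3 + 3) ≤ E := by exact_mod_cast hE2
        have h17 : (2 : ℝ) ^ (d ^ 3) * 8 ≤ E := by
          rw [pow_add] at h16; linarith
        have hω1 : ‖ω‖ ≤ 1 := by
          refine hω.trans ?_
          rw [div_le_one (by positivity)]
          calc (4 : ℝ) ≤ 1 * 8 := by norm_num
            _ ≤ (2 : ℝ) ^ (d ^ 3) * 8 := by gcongr; exact one_le_pow₀ (by norm_num)
            _ ≤ E := h17
            _ ≤ _ := le_self_pow₀ hE1 (by norm_num)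
        have h3 := Complex.norm_exp_sub_one_le hω1
        have h4 : ‖Complex.exp ω - 1‖ * 2 ^ (Module.finrank ℚ F - 1) <
            2 * (4 / (E : ℝ) ^ 4) * 2 ^ (d ^ 3) := by
          refine mul_lt_mul' (h3.trans (by linarith)) ?_ (by positivity) (by positivity)
          exact pow_lt_pow_right₀ (by norm_num) (by omega)
        have h5 : 2 * (4 / (E : ℝ) ^ 4) * 2 ^ (d ^ 3) ≤ 1 := by
          have : 2 * (4 / (E : ℝ) ^ 4) * 2 ^ (d ^ 3) = (2 ^ (d ^ 3) * 8) / (E : ℝ) ^ 4 := by ring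
          rw [this, div_le_one (by positivity)]
          exact h17.trans (le_self_pow₀ hE1 (by norm_num))
        linarith
      · intro h0
        apply hne
        rw [← hζ, sub_eq_zero.mp h0]
        simp
      · intro τ
        simp only [map_sub, map_one]
        refine (norm_sub_le _ _).trans ?_
        rw [hnorm]; norm_num
    have hexpN : Complex.exp (-(N * ω)) = 1 := by
      rw [Complex.exp_neg, Complex.exp_nat_mul, hexp]; simp
    rw [hexpN, mul_one] at hδ hδ0
    have hp0 : φ p ≠ 0 := by
      rw [map_ne_zero]; exact_mod_cast hp
    have h1 := one_le_norm_mul_pow φ (q - p) (Y := 2 * Real.exp A) ?_ ?_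
    · have h2 : φ ((q - p : 𝓞 F) : F) = (φ q / φ p - 1) * φ p := by
        field_simp; simp
      rw [h2, norm_mul] at h1
      have hbd := (aux_size_bounds hd hE2 hJ hB hs hs' hN hN' (h := 0) (by linarith)).2.2.2
      rw [← hA] at hbd
      have h2e : 2 * Real.exp A ≤ Real.exp (A + 1) := by
        rw [Real.exp_add, mul_comm]
        gcongr
        linarith [Real.add_one_le_exp (1 : ℝ)]
      have : ‖φ q / φ p - 1‖ * ‖φ p‖ * (2 * Real.exp A) ^ (Module.finrank ℚ F - 1) ≤
          Real.exp (-B) * Real.exp (A + 1) * Real.exp (A + 1) ^ (d ^ 3) := by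
        refine mul_le_mul (mul_le_mul hδ ?_ (norm_nonneg _) (Real.exp_pos _).le) ?_
          (by positivity) (by positivity)
        · exact (hpA φ).trans (Real.exp_le_exp.mpr (by linarith))
        · exact (pow_le_pow_left₀ (by positivity) h2e _).trans
            (pow_le_pow_right₀ (Real.one_le_exp (by linarith)) (by omega))
      rw [← Real.exp_nat_mul, ← Real.exp_add, ← Real.exp_add] at this
      have h4 : -B + (A + 1) + (d ^ 3 : ℕ) * (A + 1) < 0 := by
        push_cast; linarith
      have h5 := Real.exp_lt_one_iff.mpr h4
      linarith
    · intro h0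
      rw [sub_eq_zero] at h0
      apply hδ0
      rw [h0, div_self hp0, sub_self]
    · intro τ
      simp only [map_sub]
      exact (norm_sub_le _ _).trans (by linarith [hpA τ, hqA τ])

theorem norm_mul_inv_pow_le {K : Type*} [Field K] [NumberField K] {β : 𝓞 K} (hβ : β ≠ 0)
    (g : (𝓞 K)ˣ) (σ : K →+* ℂ) {N : ℕ} {s ε b : ℝ} (hN : N * s ≤ 1) (hN' : 1 < (N + 1) * s)
    (hb : |Real.log ‖σ β‖| ≤ b)
    (hg : |Real.log ‖σ (g : 𝓞 K)‖ - s * Real.log ‖σ β‖| ≤ ε) :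
    ‖σ (β * (g⁻¹ : (𝓞 K)ˣ) ^ N : 𝓞 K)‖ ≤ Real.exp (b * s + N * ε) := by
  have hβσ : 0 < ‖σ β‖ := by
    rw [norm_pos_iff, map_ne_zero]; exact_mod_cast hβ
  have hgσ : 0 < ‖σ (g : 𝓞 K)‖ := by
    rw [norm_pos_iff, map_ne_zero]
    simp
  have hinv : ‖σ ((g⁻¹ : (𝓞 K)ˣ) : 𝓞 K)‖ = ‖σ (g : 𝓞 K)‖⁻¹ := by
    apply eq_inv_of_mul_eq_one_left
    rw [← norm_mul, ← map_mul, ← map_mul]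
    simp
  have hn : ‖σ (β * (g⁻¹ : (𝓞 K)ˣ) ^ N : 𝓞 K)‖ = ‖σ β‖ * (‖σ (g : 𝓞 K)‖⁻¹) ^ N := by
    rw [← hinv]; simp
  rw [hn, ← Real.log_le_iff_le_exp (by positivity), Real.log_mul (by positivity) (by positivity),
    Real.log_pow, Real.log_inv]
  have h1 := (abs_le.mp hg).1
  have h2 : (N : ℝ) * -(Real.log ‖σ (g : 𝓞 K)‖ - s * Real.log ‖σ β‖) ≤ N * ε := by
    gcongr
    linarith
  have h3 : Real.log ‖σ β‖ * (1 - N * s) ≤ b * s := by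
    have h4 := (abs_nonneg _).trans hb
    calc Real.log ‖σ β‖ * (1 - N * s) ≤ b * (1 - N * s) := by
          gcongr
          exact (le_abs_self _).trans hb
      _ ≤ b * s := by
          gcongr
          linarith
  linarith

theorem norm_le_of_re_im {ω : ℂ} {a b : ℝ} (hre : |ω.re| ≤ a) (him : |ω.im| ≤ b) :
    ‖ω‖ ≤ a + b :=
  (Complex.norm_le_abs_re_add_abs_im ω).trans (add_le_add hre him)

theorem thue_field_contradiction {K : Type*} [Field K] [NumberField K] {d M W E J L C : ℕ}
    (hd : 3 ≤ d) (hdK : Module.finrank ℚ K = d) (θ : 𝓞 K) {Y : ℝ}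
    (hY1 : 1 ≤ Y) (hinj : ∀ σ τ : K →+* ℂ, σ θ = τ θ → σ = τ) (hY : ∀ σ : K →+* ℂ, ‖σ θ‖ ≤ Y)
    {a x y : ℤ} (ha : a ≠ 0) (haY : |(a : ℝ)| ≤ Y) {β : 𝓞 K} (hβ : β = a * x - θ * y)
    (hβ0 : β ≠ 0) {B h c : ℝ} (hX : Real.exp B = max |(x : ℝ)| |(y : ℝ)|)
    (hh : h = (d ^ 3 + 1 : ℕ) * Real.log (2 * Y)) (hc : 1 ≤ c)
    (hdisc : √|(discr K : ℝ)| < c ^ d) (hM : 3 * c ^ d ≤ M) (hW : 2 * (d * Real.log c + 5) ≤ W)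
    (hMW : (M + 1) * (W + 1) ≤ E) (hE2 : 2 ^ (d ^ 3 + 3) ≤ E) (hEh : h ≤ E)
    (hC : C = 40 * d + 68) (hL : L = 2 * (2 * d ^ 3 + 1) ^ 2 * C + 1) (hE : 64 * d * L ^ 3 < E)
    (hJ : J = E ^ (5 * d + 5)) (hB : (E : ℝ) ^ (10 * d + 16) ≤ B)
    (hB' : B ≤ (E : ℝ) ^ (20 * d + 32))
    (hm : J * Real.log |(Algebra.norm ℤ β : ℝ)| ≤ B) : False := by
  have hpow : d ^ 3 + 3 < 2 ^ (d ^ 3 + 3) := Nat.lt_two_pow_self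
  have hd3 : d ≤ d ^ 3 := Nat.le_self_pow (by norm_num) _
  have hE6 : 6 ≤ E := by omega
  have hE6r : (6 : ℝ) ≤ E := by exact_mod_cast hE6
  have hE1 : (1 : ℝ) ≤ E := by linarith
  have hE0 : (0 : ℝ) < E := by linarith
  have hdE : (d : ℝ) ≤ E := by exact_mod_cast (by omega : d ≤ E)
  have hdr : (3 : ℝ) ≤ d := by exact_mod_cast hd
  have hlogY : 0 ≤ Real.log (2 * Y) := Real.log_nonneg (by linarith)
  have hh0 : 0 ≤ h := by rw [hh]; positivity
  have hlogYh : Real.log (2 * Y) ≤ h := by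
    rw [hh]
    refine le_mul_of_one_le_left hlogY ?_
    exact_mod_cast Nat.le_add_left 1 (d ^ 3)
  have hBpos : 0 < B := lt_of_lt_of_le (by positivity) hB
  have hEEB : (E : ℝ) * E ≤ B := by
    refine le_trans ?_ hB
    rw [← sq]
    exact pow_le_pow_right₀ hE1 (by omega)
  have hBh : d * h ≤ B := by
    refine le_trans ?_ hEEB
    gcongr
  have h6E : 6 * (E : ℝ) ≤ B := (by gcongr : 6 * (E : ℝ) ≤ E * E).trans hEEB
  obtain ⟨σ₁, hσ, habs, hsmall⟩ := exists_small_conjugate hd hdK θ hY1 hinj hY ha haY hβ hβ0 hX hh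
    hBh
  obtain ⟨σ₂, h21⟩ : ∃ σ₂, σ₂ ≠ σ₁ := by
    classical
    obtain ⟨σ₂, h2⟩ := Finset.exists_mem_notMem_of_card_lt_card
      (s := {σ₁}) (t := (Finset.univ : Finset (K →+* ℂ)))
      (by rw [Finset.card_univ, Embeddings.card, hdK, Finset.card_singleton]; omega)
    exact ⟨σ₂, by simpa using h2.2⟩
  obtain ⟨σ₃, h31, h32⟩ : ∃ σ₃, σ₃ ≠ σ₁ ∧ σ₃ ≠ σ₂ := by
    classical
    obtain ⟨σ₃, h3⟩ := Finset.exists_mem_notMem_of_card_lt_card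
      (s := {σ₁, σ₂}) (t := (Finset.univ : Finset (K →+* ℂ)))
      (by rw [Finset.card_univ, Embeddings.card, hdK]
          exact (Finset.card_le_two).trans_lt (by omega))
    exact ⟨σ₃, by simpa [not_or] using h3.2⟩
  -- the approximating unit
  have hE4 : (0 : ℝ) < (E : ℝ) ^ 4 := by positivity
  have hW1 : 1 ≤ W := by
    have : (0 : ℝ) ≤ Real.log c := Real.log_nonneg hc
    have : (1 : ℝ) ≤ W := by
      refine le_trans ?_ hW
      have : 0 ≤ d * Real.log c := by positivity
      linarith
    exact_mod_cast this
  obtain ⟨s, hs, hs', g, hg, ω, hω, hωim, hωre⟩ := exists_unit_approx (M := M) (q := W * E ^ 4)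
    (J := J) (ε := 1 / (E : ℝ) ^ 4) hc (by rw [hdK]; exact hdisc) hβ0 σ₂ σ₃ hBpos hm
    (by rw [hdK]; exact hM) (by positivity) (by
      rw [hdK, hJ, ← mul_pow]
      calc ((M + 1) * (W * E ^ 4 + 1)) ^ (d + 1) ≤ ((M + 1) * ((W + 1) * E ^ 4)) ^ (d + 1) := by
            gcongr
            rw [add_mul, one_mul]
            gcongr
            exact Nat.one_le_pow _ _ (by omega)
        _ = ((M + 1) * (W + 1) * E ^ 4) ^ (d + 1) := by ring
        _ ≤ (E * E ^ 4) ^ (d + 1) := by gcongr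
        _ = _ := by rw [← pow_succ', ← pow_mul]; congr 1) (by
      rw [hdK]
      push_cast
      refine hW.trans (le_of_eq ?_)
      field_simp)
  have hs0 : 0 < s := lt_of_lt_of_le (by positivity) hs
  obtain ⟨N, hNd⟩ : ∃ N, N = ⌊1 / s⌋₊ := ⟨_, rfl⟩
  have hN : N * s ≤ 1 := by
    rw [← le_div_iff₀ hs0, hNd]
    exact Nat.floor_le (by positivity)
  have hN' : 1 < (N + 1) * s := by
    rw [← div_lt_iff₀ hs0, hNd]
    exact Nat.lt_floor_add_one _
  obtain ⟨hA, hre, hU, -⟩ := aux_size_bounds hd hE2 hJ hB hs hs' hN hN' hEh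
  have hωn : ‖ω‖ ≤ 4 / (E : ℝ) ^ 4 := by
    have h1 := abs_le.mp (hg σ₂)
    have h2 := abs_le.mp (hg σ₃)
    have h3 := abs_le.mp (hσ σ₂ h21)
    have h4 := abs_le.mp (hσ σ₃ h31)
    have h5 : s * Real.log ‖σ₃ β‖ - s * Real.log ‖σ₂ β‖ ≤ s * (2 * h) := by
      rw [← mul_sub]; gcongr; linarith
    have h6 : s * Real.log ‖σ₂ β‖ - s * Real.log ‖σ₃ β‖ ≤ s * (2 * h) := by
      rw [← mul_sub]; gcongr; linarith
    have h7 : |ω.re| ≤ 3 * (1 / (E : ℝ) ^ 4) := by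
      rw [hωre, abs_le]
      constructor <;> linarith
    have h8 := norm_le_of_re_im h7 hωim
    refine h8.trans (le_of_eq ?_)
    ring
  have hgU : ∀ σ : K →+* ℂ, ‖σ (g : 𝓞 K)‖ ≤ Real.exp (2 * d * s * B) := fun σ => by
    rw [← Real.log_le_iff_le_exp (by rw [norm_pos_iff, map_ne_zero]; simp)]
    have h1 := (abs_le.mp (hg σ)).2
    have h2 : s * Real.log ‖σ β‖ ≤ s * (d * B) := by
      gcongr
      exact (le_abs_self _).trans (habs σ)
    linarith
  set γ : 𝓞 K := β * (g⁻¹ : (𝓞 K)ˣ) ^ N with hγ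
  have hγ0 : γ ≠ 0 := mul_ne_zero hβ0 (pow_ne_zero _ (Units.ne_zero _))
  have hγle : ∀ σ : K →+* ℂ, ‖σ γ‖ * (2 * Y) ≤ Real.exp (2 * N / (E : ℝ) ^ 4) := fun σ => by
    have h1 := norm_mul_inv_pow_le hβ0 g σ hN hN' (habs σ) (hg σ)
    have h2 : 2 * Y ≤ Real.exp h := by
      rw [← Real.log_le_iff_le_exp (by linarith)]; exact hlogYh
    calc ‖σ γ‖ * (2 * Y) ≤ Real.exp (d * B * s + N * (1 / (E : ℝ) ^ 4)) * Real.exp h := by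
          gcongr
      _ ≤ _ := by
          rw [← Real.exp_add, Real.exp_le_exp]
          linarith
  have hθdiff : ∀ σ τ : K →+* ℂ, ‖σ θ - τ θ‖ ≤ 2 * Y := fun σ τ =>
    (norm_sub_le _ _).trans (by linarith [hY σ, hY τ])
  have hpos : ∀ σ : K →+* ℂ, 0 < ‖σ β‖ := fun σ => by
    rw [norm_pos_iff, map_ne_zero]
    exact_mod_cast hβ0
  have h12 : σ₁ θ - σ₂ θ ≠ 0 := fun h0 => h21 (hinj _ _ (sub_eq_zero.mp h0)).symm
  have h13 : σ₁ θ - σ₃ θ ≠ 0 := fun h0 => h31 (hinj _ _ (sub_eq_zero.mp h0)).symm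
  have h23 : σ₂ θ - σ₃ θ ≠ 0 := fun h0 => h32 (hinj _ _ (sub_eq_zero.mp h0)).symm
  have hβσ : ∀ σ : K →+* ℂ, σ β = a * x - σ θ * y := fun σ => by
    rw [hβ]; simp
  -- the small quantity supplied by Siegel's identity
  have hgN : σ₃ γ = σ₃ β * ((σ₂ (g : 𝓞 K))⁻¹ ^ N) * Complex.exp (-(N * ω)) ∧
      σ₂ γ = σ₂ β * ((σ₂ (g : 𝓞 K))⁻¹ ^ N) := by
    have hinv : ∀ σ : K →+* ℂ, σ ((g⁻¹ : (𝓞 K)ˣ) : 𝓞 K) = (σ (g : 𝓞 K))⁻¹ := fun σ => by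
      apply eq_inv_of_mul_eq_one_left
      rw [← map_mul, ← map_mul]
      simp
    constructor
    · rw [Complex.exp_neg, Complex.exp_nat_mul, mul_assoc, ← inv_pow, ← mul_pow, ← mul_inv, ← hω,
        ← hinv, hγ]
      simp
    · rw [← hinv, hγ]
      simp
  have hδeq : (σ₂ γ * (σ₁ θ - σ₃ θ)) / (σ₃ γ * (σ₁ θ - σ₂ θ)) * Complex.exp (-(N * ω)) - 1 =
      (σ₂ θ - σ₃ θ) * σ₁ β / (σ₃ β * (σ₁ θ - σ₂ θ)) := by
    have hg2 : σ₂ (g : 𝓞 K) ≠ 0 := by rw [map_ne_zero]; simp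
    have hb3 : σ₃ β ≠ 0 := norm_pos_iff.mp (hpos σ₃)
    have he := Complex.exp_ne_zero (-(N * ω))
    rw [hgN.1, hgN.2]
    have hsieg : σ₂ β * (σ₁ θ - σ₃ θ) - σ₃ β * (σ₁ θ - σ₂ θ) = (σ₂ θ - σ₃ θ) * σ₁ β := by
      rw [hβσ, hβσ, hβσ]; ring
    rw [← hsieg]
    field_simp
  have hδ0 : (σ₂ θ - σ₃ θ) * σ₁ β / (σ₃ β * (σ₁ θ - σ₂ θ)) ≠ 0 :=
    div_ne_zero (mul_ne_zero h23 (norm_pos_iff.mp (hpos σ₁)))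
      (mul_ne_zero (norm_pos_iff.mp (hpos σ₃)) h12)
  have hlogm : Real.log |(Algebra.norm ℤ β : ℝ)| ≤ B / 6 := by
    have h1 : 0 ≤ Real.log |(Algebra.norm ℤ β : ℝ)| := by
      apply Real.log_nonneg
      exact_mod_cast Int.one_le_abs (by simpa using hβ0)
    have h2 : (6 : ℝ) ≤ J := by
      rw [hJ]; push_cast
      exact hE6r.trans (le_self_pow₀ hE1 (by omega))
    have h3 : 6 * Real.log |(Algebra.norm ℤ β : ℝ)| ≤ J * Real.log |(Algebra.norm ℤ β : ℝ)| := by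
      gcongr
    linarith
  have hδ : ‖(σ₂ θ - σ₃ θ) * σ₁ β / (σ₃ β * (σ₁ θ - σ₂ θ))‖ ≤ Real.exp (-B) := by
    have hsep := one_le_norm_sub_mul_pow θ hY1 hY (σ := σ₁) (τ := σ₂) (sub_ne_zero.mp h12)
    rw [hdK] at hsep
    have hexph : Real.exp h = (2 * Y) ^ (d ^ 3 + 1) := by
      rw [hh, Real.exp_nat_mul, Real.exp_log (by linarith)]
    have hb1 : ‖σ₁ β‖ ≤ Real.exp (B / 6 + 2 * h - 2 * B) := by
      rw [← Real.log_le_iff_le_exp (hpos σ₁)]; linarith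
    have hb3 : Real.exp (B - h) ≤ ‖σ₃ β‖ := by
      rw [← Real.le_log_iff_exp_le (hpos σ₃)]
      linarith [(abs_le.mp (hσ σ₃ h31)).1]
    rw [norm_div, norm_mul, norm_mul, div_le_iff₀ (by
      have := norm_pos_iff.mpr h12
      have := hpos σ₃
      positivity)]
    calc ‖σ₂ θ - σ₃ θ‖ * ‖σ₁ β‖ ≤ 2 * Y * Real.exp (B / 6 + 2 * h - 2 * B) * 1 := by
          rw [mul_one]
          gcongr
          exact hθdiff _ _
      _ ≤ 2 * Y * Real.exp (B / 6 + 2 * h - 2 * B) * (‖σ₁ θ - σ₂ θ‖ * (2 * Y) ^ d ^ 3) := by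
          gcongr
      _ = Real.exp h * Real.exp (B / 6 + 2 * h - 2 * B) * ‖σ₁ θ - σ₂ θ‖ := by
          rw [hexph]; ring
      _ ≤ Real.exp (-B) * Real.exp (B - h) * ‖σ₁ θ - σ₂ θ‖ := by
          rw [← Real.exp_add, ← Real.exp_add]
          exact mul_le_mul_of_nonneg_right (Real.exp_le_exp.mpr (by linarith)) (norm_nonneg _)
      _ ≤ Real.exp (-B) * ‖σ₃ β‖ * ‖σ₁ θ - σ₂ θ‖ := by gcongr
      _ = _ := by ring
  rw [← hδeq] at hδ0 hδ
  -- transfer to the compositum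
  clear hδeq hgN hσ habs hg hre hA hU hlogm hsmall hωim hωre
  obtain ⟨F, _, _, φ, ψ₁, ψ₂, ψ₃, rfl, rfl, rfl, hF⟩ := exists_compositum_embeddings σ₁ σ₂ σ₃
  rw [hdK] at hF
  have hinjΨ : ∀ ψ : K →+* F, Function.Injective (RingOfIntegers.mapRingHom ψ) :=
      fun ψ z w hzw => by
    have := congrArg (fun z : 𝓞 F => (z : F)) hzw
    exact RingOfIntegers.ext (ψ.injective (by simpa using this))
  have hτ : ∀ (τ : F →+* ℂ) (ψ : K →+* F) (z : 𝓞 K),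
      τ (RingOfIntegers.mapRingHom ψ z : 𝓞 F) = (τ.comp ψ) z := fun τ ψ z => by simp
  have hpqA : ∀ (ψ ψ' ψ'' : K →+* F) (τ : F →+* ℂ), ‖τ (RingOfIntegers.mapRingHom ψ γ *
      (RingOfIntegers.mapRingHom ψ' θ - RingOfIntegers.mapRingHom ψ'' θ) : 𝓞 F)‖ ≤
      Real.exp (2 * N / (E : ℝ) ^ 4) := fun ψ ψ' ψ'' τ => by
    have h1 : τ (RingOfIntegers.mapRingHom ψ γ *
        (RingOfIntegers.mapRingHom ψ' θ - RingOfIntegers.mapRingHom ψ'' θ) : 𝓞 F) =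
        τ.comp ψ γ * (τ.comp ψ' θ - τ.comp ψ'' θ) := by simp
    rw [h1, norm_mul]
    refine le_trans ?_ (hγle (τ.comp ψ))
    gcongr
    exact hθdiff _ _
  have hpq : φ (RingOfIntegers.mapRingHom ψ₂ γ *
      (RingOfIntegers.mapRingHom ψ₁ θ - RingOfIntegers.mapRingHom ψ₃ θ) : 𝓞 F) /
      φ (RingOfIntegers.mapRingHom ψ₃ γ *
      (RingOfIntegers.mapRingHom ψ₁ θ - RingOfIntegers.mapRingHom ψ₂ θ) : 𝓞 F) =
      (φ.comp ψ₂ γ * (φ.comp ψ₁ θ - φ.comp ψ₃ θ)) /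
        (φ.comp ψ₃ γ * (φ.comp ψ₁ θ - φ.comp ψ₂ θ)) := by
    simp
  rw [← hpq] at hδ0 hδ
  refine linear_form_not_small φ hd hF hE2 hC hL hE hJ hB hB' hs hs' hN hN' rfl rfl
    (u := RingOfIntegers.mapRingHom ψ₃ (g : 𝓞 K)) (w := RingOfIntegers.mapRingHom ψ₂ (g : 𝓞 K))
    (ζ := RingOfIntegers.mapRingHom ψ₂ ((g⁻¹ : (𝓞 K)ˣ) : 𝓞 K) *
      RingOfIntegers.mapRingHom ψ₃ (g : 𝓞 K)) ?_ ?_ ?_ ?_ (fun τ => ?_) (fun τ => ?_)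
      (hpqA _ _ _) (hpqA _ _ _) ?_ hωn hδ0 hδ
  · rw [Ne, map_eq_zero_iff _ (hinjΨ _)]
    exact Units.ne_zero _
  · refine mul_ne_zero (by rwa [Ne, map_eq_zero_iff _ (hinjΨ _)]) fun h0 => h12 ?_
    have := congrArg (fun z : 𝓞 F => φ (z : F)) h0
    simpa using this
  · refine mul_ne_zero (by rwa [Ne, map_eq_zero_iff _ (hinjΨ _)]) fun h0 => h13 ?_
    have := congrArg (fun z : 𝓞 F => φ (z : F)) h0
    simpa using this
  · rw [← mul_assoc, ← map_mul]
    simp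
  · rw [hτ]; exact hgU _
  · rw [hτ]; exact hgU _
  · have h1 : φ (RingOfIntegers.mapRingHom ψ₂ ((g⁻¹ : (𝓞 K)ˣ) : 𝓞 K) *
        RingOfIntegers.mapRingHom ψ₃ (g : 𝓞 K) : 𝓞 F) =
        φ.comp ψ₂ ((g⁻¹ : (𝓞 K)ˣ) : 𝓞 K) * φ.comp ψ₃ (g : 𝓞 K) := by simp
    rw [h1, hω, ← mul_assoc, ← map_mul, ← map_mul]
    simp

section BinaryForm

open Polynomial

theorem exists_homogenize_eq {d : ℕ} {f : MvPolynomial (Fin 2) ℤ} (hhom : f.IsHomogeneous d)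
    {H : ℕ} (hH : H = f.support.sup fun mon => (f.coeff mon).natAbs) :
    ∃ P : ℤ[X], P.natDegree ≤ d ∧ P.homogenize d = f ∧ ∀ i, (P.coeff i).natAbs ≤ H := by
  have hbd : ∀ m, (f.coeff m).natAbs ≤ H := fun m => by
    by_cases hm : m ∈ f.support
    · rw [hH]
      exact Finset.le_sup (f := fun mon => (f.coeff mon).natAbs) hm
    · rw [MvPolynomial.notMem_support_iff.mp hm]; simp
  have hcoeff : ∀ i, (∑ j ∈ Finset.range (d + 1),
      monomial j (f.coeff (fun₀ | 0 => j | 1 => d - j))).coeff i =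
      if i ≤ d then f.coeff (fun₀ | 0 => i | 1 => d - i) else 0 := fun i => by
    rw [finsetSum_coeff]
    simp only [coeff_monomial]
    rw [Finset.sum_ite_eq' (Finset.range (d + 1)) i]
    simp
  refine ⟨∑ i ∈ Finset.range (d + 1), monomial i (f.coeff (fun₀ | 0 => i | 1 => d - i)),
    ?_, ?_, fun i => ?_⟩
  · rw [natDegree_le_iff_coeff_eq_zero]
    intro i hi
    rw [hcoeff, if_neg (by omega)]
  · ext m
    rw [coeff_homogenize, hcoeff]
    have hdeg : m.degree = m 0 + m 1 := by
      rw [Finsupp.degree_eq_sum, Fin.sum_univ_two]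
    split_ifs with h1 h2
    · congr 1
      ext i
      fin_cases i
      · simp
      · simp; omega
    · omega
    · exact (hhom.coeff_eq_zero (by rw [hdeg]; exact h1)).symm
  · rw [hcoeff]
    split_ifs
    · exact hbd _
    · simp

theorem not_isUnit_homogenize (P : ℚ[X]) {n : ℕ} (hn : n ≠ 0) : ¬ IsUnit (P.homogenize n) := by
  intro h
  have h1 := h.map MvPolynomial.constantCoeff
  rw [MvPolynomial.constantCoeff_eq, coeff_homogenize, if_neg (by simpa using hn.symm)] at h1
  exact not_isUnit_zero h1

theorem natDegree_eq_of_irreducible_homogenize {P : ℚ[X]} {d : ℕ} (hd : 2 ≤ d)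
    (hP : P.natDegree ≤ d) (hirr : Irreducible (P.homogenize d)) : P.natDegree = d := by
  by_contra hne
  have h1 : P.homogenize d = P.homogenize (d - 1) * (1 : ℚ[X]).homogenize 1 := by
    rw [← homogenize_mul _ _ (by omega) (by simp), mul_one]
    congr 1
    omega
  rcases hirr.isUnit_or_isUnit h1 with h | h
  · exact not_isUnit_homogenize _ (by omega) h
  · exact not_isUnit_homogenize _ (by omega) h

theorem irreducible_of_irreducible_homogenize {P : ℚ[X]} {d : ℕ} (hd : 2 ≤ d)
    (hP : P.natDegree ≤ d) (hirr : Irreducible (P.homogenize d)) : Irreducible P := by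
  have hdeg := natDegree_eq_of_irreducible_homogenize hd hP hirr
  have hP0 : P ≠ 0 := by rintro rfl; simp at hdeg; omega
  refine ⟨fun hu => ?_, fun {G Q} hGQ => ?_⟩
  · have := natDegree_eq_zero_of_isUnit hu
    omega
  · have hG : G ≠ 0 := by rintro rfl; simp at hGQ; exact hP0 hGQ
    have hQ : Q ≠ 0 := by rintro rfl; simp at hGQ; exact hP0 hGQ
    have h1 : P.homogenize d = G.homogenize G.natDegree * Q.homogenize Q.natDegree := by
      rw [← homogenize_mul _ _ le_rfl le_rfl, ← natDegree_mul hG hQ, ← hGQ, hdeg]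
    refine (hirr.isUnit_or_isUnit h1).imp (fun h => ?_) (fun h => ?_)
    · rw [isUnit_iff_degree_eq_zero, degree_eq_natDegree hG]
      by_contra h0
      exact not_isUnit_homogenize G (by exact_mod_cast h0) h
    · rw [isUnit_iff_degree_eq_zero, degree_eq_natDegree hQ]
      by_contra h0
      exact not_isUnit_homogenize Q (by exact_mod_cast h0) h

theorem norm_leadingCoeff_mul_root_le {P : ℤ[X]} {H : ℕ} (hH : ∀ i, (P.coeff i).natAbs ≤ H)
    (hP : P ≠ 0) {z : ℂ} (hz : eval z (P.map (Int.castRingHom ℂ)) = 0) :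
    ‖(P.leadingCoeff : ℂ) * z‖ ≤ 2 * H := by
  have hinj : Function.Injective (Int.castRingHom ℂ) := Int.cast_injective
  have hP' : P.map (Int.castRingHom ℂ) ≠ 0 := (Polynomial.map_ne_zero_iff hinj).mpr hP
  have hlt := IsRoot.norm_lt_cauchyBound hP' (a := z) hz
  have hco : ∀ i, ‖(P.map (Int.castRingHom ℂ)).coeff i‖₊ ≤ H := fun i => by
    rw [coeff_map, ← NNReal.coe_le_coe]
    have h1 : ((P.coeff i).natAbs : ℝ) ≤ H := by exact_mod_cast hH i
    rw [Nat.cast_natAbs, Int.cast_abs, ← Complex.norm_intCast] at h1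
    exact h1
  have hlc : 0 < ‖(P.map (Int.castRingHom ℂ)).leadingCoeff‖₊ := by
    rw [nnnorm_pos]; exact leadingCoeff_ne_zero.mpr hP'
  have hle : ‖(P.map (Int.castRingHom ℂ)).leadingCoeff‖₊ ≤ H := hco _
  have h2 : ‖(P.map (Int.castRingHom ℂ)).leadingCoeff‖₊ * ‖z‖₊ ≤ 2 * H := by
    calc _ ≤ ‖(P.map (Int.castRingHom ℂ)).leadingCoeff‖₊ *
          (P.map (Int.castRingHom ℂ)).cauchyBound := by gcongr
      _ = ((Finset.range (P.map (Int.castRingHom ℂ)).natDegree).sup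
            fun i => ‖(P.map (Int.castRingHom ℂ)).coeff i‖₊) +
            ‖(P.map (Int.castRingHom ℂ)).leadingCoeff‖₊ := by
          rw [cauchyBound, mul_add, mul_one, mul_div_cancel₀ _ hlc.ne']
      _ ≤ H + H := add_le_add (Finset.sup_le fun i _ => hco i) hle
      _ = _ := by ring
  rw [leadingCoeff_map_of_injective hinj, ← NNReal.coe_le_coe] at h2
  rw [norm_mul]
  exact h2

theorem exists_numberField_root {Q : ℚ[X]} (hQ : Irreducible Q) :
    ∃ (K : Type) (_ : Field K) (_ : NumberField K) (α : K), Module.finrank ℚ K = Q.natDegree ∧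
      (∀ σ τ : K →+* ℂ, σ α = τ α → σ = τ) ∧ eval₂ (Rat.castHom K) α Q = 0 := by
  have : Fact (Irreducible Q) := ⟨hQ⟩
  refine ⟨AdjoinRoot Q, inferInstance, inferInstance, AdjoinRoot.root Q, ?_, fun σ τ h =>
    AdjoinRoot.ringHom_ext (Subsingleton.elim _ _) h, ?_⟩
  · have := (AdjoinRoot.powerBasis hQ.ne_zero).finrank
    rw [AdjoinRoot.powerBasis_dim] at this
    convert this
  · have h1 : eval₂ (AdjoinRoot.of Q) (AdjoinRoot.root Q) Q = 0 := AdjoinRoot.eval₂_root Q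
    rwa [Subsingleton.elim (Rat.castHom (AdjoinRoot Q)) (AdjoinRoot.of Q)]

theorem map_eq_C_mul_prod_embeddings {K : Type*} [Field K] [NumberField K] {P : ℤ[X]} {α : K}
    (hdeg : P.natDegree = Module.finrank ℚ K) (hP0 : P ≠ 0)
    (hext : ∀ σ τ : K →+* ℂ, σ α = τ α → σ = τ)
    (hroot : ∀ σ : K →+* ℂ, eval (σ α) (P.map (Int.castRingHom ℂ)) = 0) :
    P.map (Int.castRingHom ℂ) = C (P.leadingCoeff : ℂ) * ∏ σ : K →+* ℂ, (X - C (σ α)) := by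
  have hinjC : Function.Injective (Int.castRingHom ℂ) := Int.cast_injective
  have haC : (P.leadingCoeff : ℂ) ≠ 0 := by exact_mod_cast leadingCoeff_ne_zero.mpr hP0
  have hcard : (Finset.univ : Finset (K →+* ℂ)).card = P.natDegree := by
    rw [Finset.card_univ, Embeddings.card, hdeg]
  have hmonic : (∏ σ : K →+* ℂ, (X - C (σ α))).Monic :=
    monic_prod_of_monic _ _ fun σ _ => monic_X_sub_C _
  have hdegR : (C (P.leadingCoeff : ℂ) * ∏ σ : K →+* ℂ, (X - C (σ α))).degree = P.natDegree := by
    rw [degree_C_mul haC, degree_prod]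
    simp [← hcard]
  have hdegL : (P.map (Int.castRingHom ℂ)).degree = P.natDegree := by
    rw [degree_map_eq_of_injective hinjC, degree_eq_natDegree hP0]
  refine eq_of_degree_sub_lt_of_eval_index_eq (v := fun σ : K →+* ℂ => σ α)
    Finset.univ (fun σ _ τ _ h => hext σ τ h) ?_ fun σ _ => ?_
  · rw [hcard, ← hdegL]
    refine degree_sub_lt_left (hdegL.trans hdegR.symm)
      ((Polynomial.map_ne_zero_iff hinjC).mpr hP0) ?_
    rw [leadingCoeff_map_of_injective hinjC, leadingCoeff_mul, leadingCoeff_C,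
      hmonic.leadingCoeff, mul_one]
    simp
  · rw [hroot, eval_mul, eval_prod, Finset.prod_eq_zero (Finset.mem_univ σ) (by simp), mul_zero]

theorem homogenize_prod_X_sub_C {ι : Type*} (s : Finset ι) (r : ι → ℂ) :
    (∏ i ∈ s, (X - C (r i))).homogenize s.card =
      ∏ i ∈ s, (MvPolynomial.X 0 - MvPolynomial.C (r i) * MvPolynomial.X 1) := by
  have h1 := homogenize_finsetProd (s := s) (p := fun i => X - C (r i)) (n := fun _ => 1)
    fun i _ => natDegree_X_sub_C_le _
  have h2 : ∀ i, (X - C (r i)).homogenize 1 =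
      MvPolynomial.X 0 - MvPolynomial.C (r i) * MvPolynomial.X 1 := fun i => by
    simp
  rw [Finset.sum_const, smul_eq_mul, mul_one] at h1
  rw [h1]
  exact Finset.prod_congr rfl fun i _ => h2 i

theorem eval_homogenize_eq_prod {ι : Type*} [Fintype ι] {P : ℤ[X]} {a : ℤ} {r : ι → ℂ}
    (hP : P.map (Int.castRingHom ℂ) = C (a : ℂ) * ∏ i, (X - C (r i))) (x y : ℤ) :
    (MvPolynomial.eval ![x, y] (P.homogenize (Fintype.card ι)) : ℂ) =
      a * ∏ i, ((x : ℂ) - r i * y) := by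
  have h1 : MvPolynomial.map (Int.castRingHom ℂ) (P.homogenize (Fintype.card ι)) =
      MvPolynomial.C (a : ℂ) *
        ∏ i, (MvPolynomial.X 0 - MvPolynomial.C (r i) * MvPolynomial.X 1) := by
    rw [← homogenize_map, hP, homogenize_C_mul]
    exact congrArg _ (homogenize_prod_X_sub_C Finset.univ r)
  have h2 := MvPolynomial.map_eval (Int.castRingHom ℂ) ![x, y] (P.homogenize (Fintype.card ι))
  rw [h1, eq_intCast, map_mul, map_prod, MvPolynomial.eval_C] at h2
  rw [h2]
  congr 1
  refine Finset.prod_congr rfl fun i _ => ?_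
  rw [map_sub, map_mul, MvPolynomial.eval_C, MvPolynomial.eval_X, MvPolynomial.eval_X]
  simp

theorem exists_field_of_binary_form {d : ℕ} (hd : 3 ≤ d) {f : MvPolynomial (Fin 2) ℤ}
    (hhom : f.IsHomogeneous d) (hirr : Irreducible (MvPolynomial.map (Int.castRingHom ℚ) f))
    {H : ℕ} (hH : H = f.support.sup fun mon => (f.coeff mon).natAbs) :
    ∃ (K : Type) (_ : Field K) (_ : NumberField K) (θ : 𝓞 K) (a : ℤ),
      Module.finrank ℚ K = d ∧ a ≠ 0 ∧ a.natAbs ≤ H ∧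
      (∀ σ τ : K →+* ℂ, σ θ = τ θ → σ = τ) ∧ (∀ σ : K →+* ℂ, ‖σ θ‖ ≤ 2 * H) ∧
      ∀ x y : ℤ, |(Algebra.norm ℤ ((a : 𝓞 K) * x - θ * y) : ℝ)| =
        |(a : ℝ)| ^ (d - 1) * |(MvPolynomial.eval ![x, y] f : ℝ)| := by
  obtain ⟨P, hPd, hPf, hPH⟩ := exists_homogenize_eq hhom hH
  have hinj : Function.Injective (Int.castRingHom ℚ) := Int.cast_injective
  have hQirr' : Irreducible ((P.map (Int.castRingHom ℚ)).homogenize d) := by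
    rwa [homogenize_map, hPf]
  have hQd' : (P.map (Int.castRingHom ℚ)).natDegree ≤ d := by
    rwa [natDegree_map_eq_of_injective hinj]
  have hQd := natDegree_eq_of_irreducible_homogenize (by omega) hQd' hQirr'
  have hQirr := irreducible_of_irreducible_homogenize (by omega) hQd' hQirr'
  have hPdeg : P.natDegree = d := by rwa [natDegree_map_eq_of_injective hinj] at hQd
  have hP0 : P ≠ 0 := by rintro rfl; simp at hPdeg; omega
  obtain ⟨K, _, _, α, hfin, hext, hα⟩ := exists_numberField_root hQirr
  rw [hQd] at hfin
  have hroot : ∀ σ : K →+* ℂ, eval (σ α) (P.map (Int.castRingHom ℂ)) = 0 := fun σ => by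
    have h1 := congrArg σ hα
    rw [hom_eval₂, map_zero, eval₂_map] at h1
    rwa [eval_map, RingHom.ext_int (Int.castRingHom ℂ)]
  have hα_int : IsIntegral ℤ ((P.leadingCoeff : K) * α) := by
    have := isIntegral_leadingCoeff_smul P α (by
      rw [eval₂_map] at hα
      rwa [aeval_def, RingHom.ext_int (algebraMap ℤ K)])
    rwa [zsmul_eq_mul] at this
  obtain ⟨θ, hθ⟩ : ∃ θ : 𝓞 K, (θ : K) = P.leadingCoeff * α := ⟨⟨_, hα_int⟩, rfl⟩
  have hσθ : ∀ σ : K →+* ℂ, σ θ = P.leadingCoeff * σ α := fun σ => by rw [hθ]; simp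
  have ha0 : P.leadingCoeff ≠ 0 := leadingCoeff_ne_zero.mpr hP0
  refine ⟨K, inferInstance, inferInstance, θ, P.leadingCoeff, hfin, ha0, hPH _,
    fun σ τ h => hext σ τ ?_, fun σ => ?_, fun x y => ?_⟩
  · have haC : (P.leadingCoeff : ℂ) ≠ 0 := by exact_mod_cast ha0
    rw [hσθ, hσθ] at h
    exact mul_left_cancel₀ haC h
  · rw [hσθ]
    exact norm_leadingCoeff_mul_root_le hPH hP0 (hroot σ)
  · have hcard : Fintype.card (K →+* ℂ) = d := by rw [Embeddings.card, hfin]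
    have hfC := eval_homogenize_eq_prod (map_eq_C_mul_prod_embeddings (hPdeg.trans hfin.symm) hP0
      hext hroot) x y
    rw [hcard, hPf] at hfC
    have h5 := prod_norm_embeddings_eq ((P.leadingCoeff : 𝓞 K) * (x : 𝓞 K) - θ * (y : 𝓞 K))
    rw [Nat.cast_natAbs, Int.cast_abs] at h5
    rw [← h5]
    have h6 : ∀ σ : K →+* ℂ, ‖σ ((P.leadingCoeff : 𝓞 K) * (x : 𝓞 K) - θ * (y : 𝓞 K) : 𝓞 K)‖ =
        |(P.leadingCoeff : ℝ)| * ‖(x : ℂ) - σ α * y‖ := fun σ => by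
      rw [← Complex.norm_intCast, ← norm_mul]
      congr 1
      have : σ ((P.leadingCoeff : 𝓞 K) * (x : 𝓞 K) - θ * (y : 𝓞 K) : 𝓞 K) =
          P.leadingCoeff * x - σ θ * y := by
        simp
      rw [this, hσθ]
      ring
    rw [Finset.prod_congr rfl fun σ _ => h6 σ, Finset.prod_mul_distrib, Finset.prod_const,
      Finset.card_univ, hcard]
    have h7 := congrArg norm hfC
    rw [norm_mul, norm_prod, Complex.norm_intCast, Complex.norm_intCast] at h7
    rw [h7, ← mul_assoc, ← pow_succ]
    congr 2
    omega

end BinaryForm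

theorem factorial_lt_self_pow {n : ℕ} (hn : 2 ≤ n) : n.factorial < n ^ n := by
  obtain ⟨k, rfl⟩ := Nat.exists_eq_add_of_le' (show 1 ≤ n by omega)
  calc (k + 1).factorial ≤ (k + 1) * k ^ k := by
        rw [Nat.factorial_succ]
        exact Nat.mul_le_mul_left _ (Nat.factorial_le_pow k)
    _ < (k + 1) * (k + 1) ^ k := by gcongr <;> omega
    _ = (k + 1) ^ (k + 1) := (pow_succ' _ _).symm

theorem thue_parameter_bounds {d H E : ℕ} (hd : 3 ≤ d) (hH : 1 ≤ H)
    (hE : d ^ (3 * d ^ 3) * H ^ (2 * d ^ 2) ≤ E) :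
    (3 * (d * (2 * H) ^ d) ^ d + 1) * (2 * d * (d * (2 * H) ^ d) + 10 + 1) ≤ E ∧
      2 ^ (d ^ 3 + 3) ≤ E ∧ (d ^ 3 + 1) * (4 * H) ≤ E ∧
      64 * d * (2 * (2 * d ^ 3 + 1) ^ 2 * (40 * d + 68) + 1) ^ 3 < E ∧ d * H ≤ E := by
  have hd1 : 1 ≤ d := by omega
  have key : ∀ i j : ℕ, i ≤ 3 * d ^ 3 → j ≤ 2 * d ^ 2 → d ^ i * H ^ j ≤ E := fun i j hi hj =>
    (Nat.mul_le_mul (Nat.pow_le_pow_right hd1 hi) (Nat.pow_le_pow_right hH hj)).trans hE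
  have hd2 : 3 * d ≤ d ^ 2 := by nlinarith
  have hd3 : 3 * d ^ 2 ≤ d ^ 3 := by rw [pow_succ d 2]; nlinarith
  have h27 : 27 ≤ d ^ 3 := by omega
  have hc : d * (2 * H) ^ d ≤ d ^ (d + 1) * H ^ d := by
    calc d * (2 * H) ^ d = d * (2 ^ d * H ^ d) := by rw [mul_pow]
      _ ≤ d * (d ^ d * H ^ d) := by gcongr; omega
      _ = _ := by ring
  have hc1 : 1 ≤ d ^ (d + 1) * H ^ d := Nat.one_le_iff_ne_zero.mpr (by positivity)
  refine ⟨?_, ?_, ?_, ?_, ?_⟩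
  · refine le_trans ?_ (key ((d + 1) * d + 2 + (d + 4)) (d * d + d) ?_ ?_)
    · have h1 : 3 * (d * (2 * H) ^ d) ^ d + 1 ≤ d ^ ((d + 1) * d + 2) * H ^ (d * d) := by
        calc _ ≤ 3 * (d ^ (d + 1) * H ^ d) ^ d + (d ^ (d + 1) * H ^ d) ^ d := by
              gcongr
              exact Nat.one_le_pow _ _ hc1
          _ = 4 * (d ^ (d + 1) * H ^ d) ^ d := by ring
          _ ≤ d ^ 2 * (d ^ (d + 1) * H ^ d) ^ d := by gcongr; omega
          _ = _ := by rw [mul_pow, ← pow_mul, ← pow_mul]; ring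
      have h2 : 2 * d * (d * (2 * H) ^ d) + 10 + 1 ≤ d ^ (d + 4) * H ^ d := by
        calc _ ≤ 2 * d * (d ^ (d + 1) * H ^ d) + 11 * (d ^ (d + 1) * H ^ d) := by
              have := Nat.mul_le_mul_left (2 * d) hc
              omega
          _ = (2 * d + 11) * (d ^ (d + 1) * H ^ d) := by ring
          _ ≤ d ^ 3 * (d ^ (d + 1) * H ^ d) := by gcongr; omega
          _ = _ := by ring
      calc _ ≤ _ := Nat.mul_le_mul h1 h2
        _ = _ := by rw [pow_add d ((d + 1) * d + 2), pow_add H]; ring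
    · have : (d + 1) * d = d ^ 2 + d := by ring
      omega
    · have : d * d = d ^ 2 := by ring
      omega
  · refine le_trans ?_ (key (d ^ 3 + 3) 0 (by omega) (by omega))
    rw [pow_zero, mul_one]
    gcongr
    omega
  · refine le_trans ?_ (key 6 1 (by omega) (by omega))
    calc (d ^ 3 + 1) * (4 * H) = (4 * d ^ 3 + 4) * H := by ring
      _ ≤ d ^ 6 * H := by
        gcongr
        have : d ^ 6 = d ^ 3 * d ^ 3 := by ring
        nlinarith
      _ = _ := by ring
  · refine lt_of_lt_of_le ?_ (key 47 0 (by omega) (by omega))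
    rw [pow_zero, mul_one]
    have h4 : 2 * d ^ 3 + 1 ≤ d ^ 4 := by rw [pow_succ d 3]; nlinarith
    have h5 : 40 * d + 68 ≤ d ^ 5 := by
      have : d ^ 5 = d ^ 3 * d ^ 2 := by ring
      nlinarith
    have h13 : 1 ≤ d ^ 13 := Nat.one_le_pow _ _ hd1
    have hL : 2 * (2 * d ^ 3 + 1) ^ 2 * (40 * d + 68) + 1 ≤ d ^ 14 := by
      calc _ ≤ 2 * (d ^ 4) ^ 2 * d ^ 5 + d ^ 13 := by gcongr
        _ = 3 * d ^ 13 := by ring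
        _ ≤ d * d ^ 13 := by gcongr
        _ = _ := by ring
    have h81 : 64 < d ^ 4 := by rw [pow_succ d 3]; nlinarith
    calc _ ≤ 64 * d * (d ^ 14) ^ 3 := by gcongr
      _ = 64 * d ^ 43 := by ring
      _ < d ^ 4 * d ^ 43 := by gcongr
      _ = _ := by ring
  · have := key 1 1 (by omega) (by omega)
    simpa using this

theorem exists_nat_pow_le_lt_pow {B : ℝ} (hB : 0 ≤ B) {n : ℕ} (hn : n ≠ 0) :
    ∃ E : ℕ, (E : ℝ) ^ n ≤ B ∧ B < ((E : ℝ) + 1) ^ n := by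
  have h1 : (B ^ (1 / (n : ℝ))) ^ n = B := by
    rw [one_div]
    exact Real.rpow_inv_natCast_pow hB hn
  have h0 : 0 ≤ B ^ (1 / (n : ℝ)) := by positivity
  refine ⟨⌊B ^ (1 / (n : ℝ))⌋₊, ?_, ?_⟩
  · calc _ ≤ (B ^ (1 / (n : ℝ))) ^ n := by gcongr; exact Nat.floor_le h0
      _ = B := h1
  · calc B = (B ^ (1 / (n : ℝ))) ^ n := h1.symm
      _ < _ := by gcongr; exact Nat.lt_floor_add_one _

theorem pow_mul_add_le_of_pow_four_le {d E : ℕ} {B l s : ℝ} (hE : 2 ≤ E) (hl : 0 ≤ l)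
    (hs : s ≤ E) (hlB : l ≤ 1 ∨ l ^ 4 ≤ B) (hB : (E : ℝ) ^ (10 * d + 16) ≤ B) :
    (E : ℝ) ^ (5 * d + 5) * (s + l) ≤ B := by
  have hE2 : (2 : ℝ) ≤ E := by exact_mod_cast hE
  have hE1 : (1 : ℝ) ≤ E := by linarith
  have hB1 : 1 ≤ B := (one_le_pow₀ hE1).trans hB
  rcases le_total l E with h | h
  · calc (E : ℝ) ^ (5 * d + 5) * (s + l) ≤ (E : ℝ) ^ (5 * d + 5) * (E * E) := by
          gcongr
          nlinarith
      _ = (E : ℝ) ^ (5 * d + 7) := by ring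
      _ ≤ (E : ℝ) ^ (10 * d + 16) := pow_le_pow_right₀ hE1 (by omega)
      _ ≤ B := hB
  · have hl4 : l ^ 4 ≤ B := hlB.resolve_left (by linarith)
    have h1 : (E : ℝ) ^ (5 * d + 5) * (s + l) ≤ (E : ℝ) ^ (5 * d + 6) * l := by
      calc (E : ℝ) ^ (5 * d + 5) * (s + l) ≤ (E : ℝ) ^ (5 * d + 5) * (E * l) := by
            gcongr
            nlinarith
        _ = _ := by ring
    refine h1.trans (le_of_pow_le_pow_left₀ four_ne_zero (by positivity) ?_)
    calc ((E : ℝ) ^ (5 * d + 6) * l) ^ 4 = (E : ℝ) ^ (20 * d + 24) * l ^ 4 := by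
          rw [mul_pow, ← pow_mul]; ring_nf
      _ ≤ ((E : ℝ) ^ (10 * d + 16)) ^ 2 * l ^ 4 := by
          rw [← pow_mul]
          gcongr ?_ * _
          exact pow_le_pow_right₀ hE1 (by omega)
      _ ≤ B ^ 2 * B := by gcongr
      _ = B ^ 3 := by ring
      _ ≤ B ^ 4 := pow_le_pow_right₀ hB1 (by omega)

theorem pow_le_baker_constant {d H : ℕ} {κ ν : ℝ} (hd : 3 ≤ d) (hH : 1 ≤ H)
    (hκ : (d : ℝ) + 1 < κ) (hν : ν = 32 * κ ^ 2 * d / (κ - d - 1)) :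
    ((d : ℝ) ^ (3 * d ^ 3) * (H : ℝ) ^ (2 * d ^ 2)) ^ (10 * d + 16) ≤
      (d : ℝ) ^ (ν ^ 2) * (H : ℝ) ^ (ν * (d : ℝ) ^ 3) := by
  have hd3 : (3 : ℝ) ≤ d := by exact_mod_cast hd
  have hd1 : (1 : ℝ) ≤ d := by linarith
  have hH1 : (1 : ℝ) ≤ H := by exact_mod_cast hH
  have hν1 : 32 * (d : ℝ) ^ 2 ≤ ν := by
    rw [hν, le_div_iff₀ (by linarith)]
    have h1 : (d : ℝ) * (κ - d - 1) ≤ κ ^ 2 := by nlinarith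
    nlinarith
  have hν0 : 0 ≤ ν := by nlinarith
  have hexp : (10 * (d : ℝ) + 16) ≤ 16 * d := by linarith
  rw [mul_pow, ← pow_mul, ← pow_mul, ← Real.rpow_natCast (d : ℝ), ← Real.rpow_natCast (H : ℝ)]
  refine mul_le_mul (Real.rpow_le_rpow_of_exponent_le hd1 ?_)
    (Real.rpow_le_rpow_of_exponent_le hH1 ?_) (by positivity) (by positivity)
  · push_cast
    calc 3 * (d : ℝ) ^ 3 * (10 * d + 16) ≤ 3 * (d : ℝ) ^ 3 * (16 * d) := by gcongr
      _ ≤ (32 * (d : ℝ) ^ 2) ^ 2 := by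
        have : 0 ≤ (d : ℝ) ^ 4 := by positivity
        nlinarith
      _ ≤ ν ^ 2 := by gcongr
  · push_cast
    calc 2 * (d : ℝ) ^ 2 * (10 * d + 16) ≤ 2 * (d : ℝ) ^ 2 * (16 * d) := by gcongr
      _ = 32 * 1 * (d : ℝ) ^ 3 := by ring
      _ ≤ 32 * (d : ℝ) ^ 2 * (d : ℝ) ^ 3 := by
        gcongr
        exact one_le_pow₀ hd1
      _ ≤ ν * (d : ℝ) ^ 3 := by gcongr

theorem thue_field_contradiction_of_le {K : Type*} [Field K] [NumberField K] {d H : ℕ}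
    (hd : 3 ≤ d) (hH : 1 ≤ H) (hdK : Module.finrank ℚ K = d) (θ : 𝓞 K)
    (hinj : ∀ σ τ : K →+* ℂ, σ θ = τ θ → σ = τ) (hY : ∀ σ : K →+* ℂ, ‖σ θ‖ ≤ 2 * H)
    {a x y m : ℤ} (ha : a ≠ 0) (haH : a.natAbs ≤ H) (hm : m ≠ 0)
    (hnorm : |(Algebra.norm ℤ ((a : 𝓞 K) * x - θ * y) : ℝ)| = |(a : ℝ)| ^ (d - 1) * |(m : ℝ)|)
    {B : ℝ} (hX : Real.exp B = max |(x : ℝ)| |(y : ℝ)|)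
    (hB : ((d : ℝ) ^ (3 * d ^ 3) * (H : ℝ) ^ (2 * d ^ 2)) ^ (10 * d + 16) ≤ B)
    (hlm : Real.log |(m : ℝ)| ≤ 1 ∨ Real.log |(m : ℝ)| ^ 4 ≤ B) : False := by
  have hH1 : (1 : ℝ) ≤ H := by exact_mod_cast hH
  have hB0 : 0 ≤ B := le_trans (by positivity) hB
  obtain ⟨E, hEB, hBE⟩ := exists_nat_pow_le_lt_pow hB0 (n := 10 * d + 16) (by omega)
  have hE0 : d ^ (3 * d ^ 3) * H ^ (2 * d ^ 2) ≤ E := by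
    have h1 := lt_of_pow_lt_pow_left₀ _ (by positivity) (hB.trans_lt hBE)
    have h2 : d ^ (3 * d ^ 3) * H ^ (2 * d ^ 2) < E + 1 := by exact_mod_cast h1
    omega
  obtain ⟨hMW, hE2, hEh, hEL, hEs⟩ := thue_parameter_bounds hd hH hE0
  have hE_two : 2 ≤ E := by nlinarith
  have haR : (|(a : ℝ)| : ℝ) ≤ H := by
    rw [← Int.cast_abs, ← Nat.cast_natAbs]
    exact_mod_cast haH
  have ha0 : 0 < |(a : ℝ)| := by positivity
  have hm0 : 0 < |(m : ℝ)| := by positivity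
  have hm1 : 1 ≤ |(m : ℝ)| := by exact_mod_cast Int.one_le_abs hm
  have ha1 : 1 ≤ |(a : ℝ)| := by exact_mod_cast Int.one_le_abs ha
  have hβ0 : (a : 𝓞 K) * x - θ * y ≠ 0 := fun h => by
    rw [h, Algebra.norm_zero, Int.cast_zero, abs_zero] at hnorm
    exact absurd hnorm (by positivity)
  have hc1 : 1 ≤ d * (2 * H) ^ d := Nat.one_le_iff_ne_zero.mpr (by positivity)
  have hc1R : (1 : ℝ) ≤ ((d * (2 * H) ^ d : ℕ) : ℝ) := by exact_mod_cast hc1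
  refine thue_field_contradiction (d := d) (M := 3 * (d * (2 * H) ^ d) ^ d)
    (W := 2 * d * (d * (2 * H) ^ d) + 10) (E := E) (Y := 2 * H) (c := ((d * (2 * H) ^ d : ℕ) : ℝ))
    hd hdK θ (by linarith) hinj hY ha (by linarith) rfl hβ0 hX rfl hc1R ?_ ?_ ?_ hMW hE2 ?_
    rfl rfl hEL rfl hEB ?_ ?_
  · calc _ ≤ ((Module.finrank ℚ K).factorial : ℝ) * (2 * H) ^ (Module.finrank ℚ K ^ 2) :=
          sqrt_abs_discr_le θ (by linarith) hinj hY
      _ < (d : ℝ) ^ d * (2 * H) ^ (d ^ 2) := by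
          rw [hdK]
          gcongr
          exact_mod_cast factorial_lt_self_pow (by omega)
      _ = _ := by push_cast; rw [mul_pow (d : ℝ), ← pow_mul, sq]
  · push_cast; rfl
  · have h1 := Real.log_le_self (zero_le_one.trans hc1R)
    calc _ ≤ 2 * ((d : ℝ) * ((d * (2 * H) ^ d : ℕ) : ℝ) + 5) := by gcongr
      _ = _ := by push_cast; ring
  · calc _ ≤ ((d ^ 3 + 1 : ℕ) : ℝ) * (2 * (2 * H)) := by
          gcongr
          exact Real.log_le_self (by positivity)
      _ = (((d ^ 3 + 1) * (4 * H) : ℕ) : ℝ) := by push_cast; ring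
      _ ≤ E := by exact_mod_cast hEh
  · have hE_two' : (2 : ℝ) ≤ E := by exact_mod_cast hE_two
    calc B ≤ ((E : ℝ) + 1) ^ (10 * d + 16) := hBE.le
      _ ≤ ((E : ℝ) ^ 2) ^ (10 * d + 16) := by gcongr; nlinarith
      _ = _ := by rw [← pow_mul]; congr 1; ring
  · rw [hnorm, Real.log_mul (by positivity) hm0.ne', Real.log_pow, Nat.cast_pow]
    refine pow_mul_add_le_of_pow_four_le hE_two (Real.log_nonneg hm1) ?_ hlm hEB
    calc ((d - 1 : ℕ) : ℝ) * Real.log |(a : ℝ)| ≤ (d : ℝ) * H := by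
          gcongr
          · exact Real.log_nonneg ha1
          · omega
          · exact (Real.log_le_self ha0.le).trans haR
      _ ≤ E := by exact_mod_cast hEs

end NumberFieldEstimates

/-- **Baker's explicit effective bound for the Thue equation (1968).**
Let `f(x, y)` be a homogeneous polynomial of degree `d ≥ 3` with rational integer
coefficients, irreducible over `ℚ`, with `H` the maximum of the absolute values of its
coefficients, and let `m ≠ 0` be a rational integer. For `κ > d + 1`, with
`ν = 32 κ² d / (κ − d − 1)` and `C = exp(d^(ν²) H^(ν d³))`, all rational integers
`x`, `y` with `f(x, y) = m` satisfy `max {|x|, |y|} < C exp((log |m|)^κ)`. -/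
theorem baker_thue_general (d : ℕ) (hd : 3 ≤ d) (f : MvPolynomial (Fin 2) ℤ)
    (hhom : f.IsHomogeneous d)
    (hirr : Irreducible (MvPolynomial.map (Int.castRingHom ℚ) f))
    (H : ℕ) (hH : H = f.support.sup fun mon => (f.coeff mon).natAbs)
    (m : ℤ) (hm : m ≠ 0) (κ : ℝ) (hκ : (d : ℝ) + 1 < κ)
    (ν : ℝ) (hν : ν = 32 * κ ^ 2 * d / (κ - d - 1))
    (C : ℝ) (hC : C = Real.exp ((d : ℝ) ^ (ν ^ 2) * (H : ℝ) ^ (ν * (d : ℝ) ^ 3)))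
    (x y : ℤ) (hxy : MvPolynomial.eval ![x, y] f = m) :
    ((max |x| |y| : ℤ) : ℝ) < C * Real.exp (Real.log |(m : ℝ)| ^ κ) := by
  by_contra hlt
  rw [not_lt, hC, ← Real.exp_add, Int.cast_max, Int.cast_abs, Int.cast_abs] at hlt
  obtain ⟨K, _, _, θ, a, hfin, ha, haH, hinj, hY, hnorm⟩ := exists_field_of_binary_form hd hhom
    hirr hH
  have hH1 : 1 ≤ H := (Int.natAbs_pos.mpr ha).trans_le haH
  have hd3 : (3 : ℝ) ≤ d := by exact_mod_cast hd
  have hm1 : 1 ≤ |(m : ℝ)| := by exact_mod_cast Int.one_le_abs hm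
  have hX0 : 0 < max |(x : ℝ)| |(y : ℝ)| := (Real.exp_pos _).trans_le hlt
  have hB := (Real.le_log_iff_exp_le hX0).mpr hlt
  have hn := hnorm x y
  rw [hxy] at hn
  have hl0 := Real.log_nonneg hm1
  refine thue_field_contradiction_of_le hd hH1 hfin θ hinj hY ha haH hm hn (Real.exp_log hX0)
    ((pow_le_baker_constant hd hH1 hκ hν).trans (le_trans ?_ hB)) ?_
  · exact le_add_of_nonneg_right (Real.rpow_nonneg hl0 κ)
  · refine (le_total (Real.log |(m : ℝ)|) 1).imp_right fun hl => ?_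
    calc Real.log |(m : ℝ)| ^ 4 = Real.log |(m : ℝ)| ^ ((4 : ℕ) : ℝ) :=
          (Real.rpow_natCast _ 4).symm
      _ ≤ Real.log |(m : ℝ)| ^ κ := Real.rpow_le_rpow_of_exponent_le hl (by push_cast; linarith)
      _ ≤ _ := le_add_of_nonneg_left (by positivity)
      _ ≤ _ := hB
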